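/- Suppose that u solves the obstacle problem in K_{g,h}(Ω,Ω'). Let x₀ ∈ ∂Ω and let r ∈ (0, r₀) with r₀ := dist(x₀, ∂Ω'). If max{ esssup_{B_r(x₀)} g, esssup_{B_r(x₀)∩Ω} h } < ∞ and essinf_{B_r(x₀)} g > −∞, then u is essentially bounded in B_{r/2}(x₀), i.e. esssup_{B_{r/2}(x₀)} |u| < ∞. -/

import Mathlib

open MeasureTheory Metric Filter
open scoped ENNReal Topology

noncomputable section

/-- `ℝ^n`. -/
abbrev Euc (n : ℕ) := EuclideanSpace ℝ (Fin n)

/-- `L(a,b) = |a-b|^{p-2}(a-b)` (real powers; the convention `L(a,a)=0` holds automatically). -/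
noncomputable def Lf (p a b : ℝ) : ℝ := |a - b| ^ (p - 2) * (a - b)

/-- A symmetric measurable kernel of order `(s,p)` with ellipticity constant `Λ`. -/
def IsKernel (n : ℕ) (s p Λ : ℝ) (K : Euc n → Euc n → ℝ) : Prop :=
  Measurable (Function.uncurry K) ∧
  (∀ x y, K x y = K y x) ∧ (∀ x y, 0 ≤ K x y) ∧
  (∀ᵐ z : Euc n × Euc n, Λ⁻¹ ≤ K z.1 z.2 * ‖z.1 - z.2‖ ^ ((n : ℝ) + s * p) ∧
    K z.1 z.2 * ‖z.1 - z.2‖ ^ ((n : ℝ) + s * p) ≤ Λ)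

/-- Membership in the fractional Sobolev space `W^{s,p}(D)` (finiteness of the norm). -/
def MemW (n : ℕ) (s p : ℝ) (D : Set (Euc n)) (v : Euc n → ℝ) : Prop :=
  AEMeasurable v (volume.restrict D) ∧
  IntegrableOn (fun x => |v x| ^ p) D volume ∧
  Integrable (fun q : Euc n × Euc n => |v q.1 - v q.2| ^ p / ‖q.1 - q.2‖ ^ ((n : ℝ) + s * p))
    ((volume.restrict D).prod (volume.restrict D))

/-- The `W^{s,p}(D)` norm. -/
noncomputable def sobNorm (n : ℕ) (s p : ℝ) (D : Set (Euc n)) (v : Euc n → ℝ) : ℝ :=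
  (∫ x in D, |v x| ^ p) ^ (1/p) +
  (∫ x in D, ∫ y in D, |v x - v y| ^ p / ‖x - y‖ ^ ((n : ℝ) + s * p)) ^ (1/p)

/-- The nonlocal tail `Tail(f; z, r)`. -/
noncomputable def tailF (n : ℕ) (s p : ℝ) (f : Euc n → ℝ) (z : Euc n) (r : ℝ) : ℝ :=
  (r ^ (s * p) * ∫ x in (ball z r)ᶜ, |f x| ^ (p - 1) * ‖x - z‖ ^ (-((n : ℝ) + s * p))) ^ (1/(p-1))

/-- Membership in the tail space `L^{p-1}_{sp}(ℝ^n)`. -/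
def MemTail (n : ℕ) (s p : ℝ) (f : Euc n → ℝ) : Prop :=
  AEMeasurable f volume ∧
  (∀ z : Euc n, ∀ r : ℝ, 0 < r → IntegrableOn (fun x => |f x| ^ (p - 1)) (ball z r) volume) ∧
  (∀ z : Euc n, ∀ r : ℝ, 0 < r →
    IntegrableOn (fun x => |f x| ^ (p - 1) * ‖x - z‖ ^ (-((n : ℝ) + s * p))) (ball z r)ᶜ volume)

/-- The admissible class `K_{g,h}(Ω,Ω')`. -/
def obstacleSet (n : ℕ) (s p : ℝ) (Ω Ω' : Set (Euc n)) (g : Euc n → ℝ) (h : Euc n → EReal) :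
    Set (Euc n → ℝ) :=
  {u | MemW n s p Ω' u ∧ (∀ᵐ x ∂(volume : Measure (Euc n)), x ∈ Ω → h x ≤ (u x : EReal)) ∧
    (∀ᵐ x ∂(volume : Measure (Euc n)), x ∉ Ω → u x = g x)}

/-- The functional `A u (v)`. -/
noncomputable def Aop (n : ℕ) (p : ℝ) (Ω Ω' : Set (Euc n)) (g : Euc n → ℝ)
    (K : Euc n → Euc n → ℝ) (u v : Euc n → ℝ) : ℝ :=
  (∫ x in Ω', ∫ y in Ω', Lf p (u x) (u y) * (v x - v y) * K x y) +
  2 * ∫ y in Ω'ᶜ, ∫ x in Ω, Lf p (u x) (g y) * v x * K x y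

/-- `u` solves the obstacle problem in `K_{g,h}(Ω,Ω')`. -/
def SolvesObstacle (n : ℕ) (s p : ℝ) (Ω Ω' : Set (Euc n)) (g : Euc n → ℝ) (h : Euc n → EReal)
    (K : Euc n → Euc n → ℝ) (u : Euc n → ℝ) : Prop :=
  u ∈ obstacleSet n s p Ω Ω' g h ∧
  ∀ v ∈ obstacleSet n s p Ω Ω' g h, 0 ≤ Aop n p Ω Ω' g K u (fun x => v x - u x)

/-- The essential oscillation of `f` on `A` (in `EReal`). -/
noncomputable def essOsc (n : ℕ) (A : Set (Euc n)) (f : Euc n → ℝ) : EReal :=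
  essSup (fun x => (f x : EReal)) (volume.restrict A) -
    essInf (fun x => (f x : EReal)) (volume.restrict A)

end

lemma rpow_split {p : ℝ} (hp : 1 < p) {α d l : ℝ} (hα : 0 ≤ α) (hd : 0 ≤ d) (hl0 : 0 < l)
    (hl1 : l < 1) : (α + d) ^ p ≤ l ^ (1 - p) * α ^ p + (1 - l) ^ (1 - p) * d ^ p := by
  have h1l : 0 < 1 - l := by linarith
  have h := (convexOn_rpow hp.le).2 (x := α / l) (y := d / (1 - l)) (by simp; positivity)
    (by simp; positivity) hl0.le h1l.le (by ring)
  simp only [smul_eq_mul] at h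
  rw [mul_div_cancel₀ _ hl0.ne', mul_div_cancel₀ _ h1l.ne',
    Real.div_rpow hα hl0.le, Real.div_rpow hd h1l.le] at h
  rw [Real.rpow_sub hl0, Real.rpow_sub h1l, Real.rpow_one, Real.rpow_one]
  calc _ ≤ _ := h
    _ = _ := by ring

lemma alg_aux {p : ℝ} (hp : 1 < p) {a b α β : ℝ} (hb : 0 ≤ b) (hab : b ≤ a) (hα : 0 ≤ α)
    (hβ : 0 ≤ β) :
    -((min 1 (1 / (p - 1))) ^ (1 - p) * a ^ p * |α - β| ^ p) ≤
      (a - b) ^ (p - 1) * (α ^ p * a - β ^ p * b) := by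
  set c := min 1 (1 / (p - 1)) with hc
  have hp1 : 0 < p - 1 := by linarith
  have hc0 : 0 < c := by rw [hc]; positivity
  have hc1 : c ≤ 1 := min_le_left _ _
  have hc2 : c * (p - 1) ≤ 1 := by
    have : c ≤ 1 / (p - 1) := min_le_right _ _
    rwa [le_div_iff₀ hp1] at this
  have ha : 0 ≤ a := hb.trans hab
  have hneg : -(c ^ (1 - p) * a ^ p * |α - β| ^ p) ≤ 0 := by
    have : 0 ≤ c ^ (1 - p) * a ^ p * |α - β| ^ p := by positivity
    linarith
  have hab' : 0 ≤ a - b := by linarith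
  rcases le_or_gt β α with h | h
  · refine hneg.trans (mul_nonneg (by positivity) ?_)
    have h1 : β ^ p ≤ α ^ p := Real.rpow_le_rpow hβ h (by linarith)
    have h2 : β ^ p * b ≤ α ^ p * a := mul_le_mul h1 hab hb (by positivity)
    linarith
  rcases hb.eq_or_lt with h0 | hb0
  · subst h0
    refine hneg.trans (mul_nonneg (by positivity) ?_)
    have : 0 ≤ α ^ p * a := by positivity
    linarith
  rcases hab.eq_or_lt with h0 | hab0
  · subst h0
    simpa [Real.zero_rpow hp1.ne'] using hneg
  have ha0 : 0 < a := hb0.trans hab0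
  set t := (a - b) / a with ht
  have ht0 : 0 < t := by rw [ht]; apply div_pos <;> linarith
  have ht1 : t < 1 := by rw [ht, div_lt_one ha0]; linarith
  have hat : a * t = a - b := by rw [ht]; field_simp
  have hct : c * t < 1 := by nlinarith
  have hct0 : 0 < c * t := by positivity
  have hs := rpow_split hp hα (sub_nonneg.2 h.le) (l := 1 - c * t) (by linarith) (by linarith)
  rw [add_sub_cancel, sub_sub_cancel] at hs
  -- key
  have hkey : 1 - t ≤ (1 - c * t) ^ (p - 1) := by
    rcases le_total 1 (p - 1) with h1 | h1
    · have := one_add_mul_self_le_rpow_one_add (s := -(c * t)) (by linarith) h1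
      have h3 : 1 - t ≤ 1 + (p - 1) * -(c * t) := by nlinarith
      refine h3.trans (this.trans_eq (by ring_nf))
    · have hc' : c = 1 := by
        rw [hc, min_eq_left]; rw [le_div_iff₀ hp1]; linarith
      rw [hc', one_mul]
      have := Real.rpow_le_rpow_of_exponent_ge (x := 1 - t) (by linarith) (by linarith) h1
      simpa using this
  have hkey2 : b * (1 - c * t) ^ (1 - p) ≤ a := by
    have : (1 - p) = -(p - 1) := by ring
    rw [this, Real.rpow_neg (by linarith), ← div_eq_mul_inv, div_le_iff₀ (by apply Real.rpow_pos_of_pos; linarith)]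
    have : b = a * (1 - t) := by rw [mul_sub, hat]; ring
    rw [this]; gcongr
  have hd : |α - β| = β - α := by rw [abs_sub_comm, abs_of_pos]; linarith
  rw [hd]
  have h5 : -(a * (c * t) ^ (1 - p) * (β - α) ^ p) ≤ α ^ p * a - β ^ p * b := by
    have e1 := mul_le_mul_of_nonneg_right hs hb
    have e2 := mul_le_mul_of_nonneg_right hkey2 (show 0 ≤ α ^ p by positivity)
    have e3 : b * ((c * t) ^ (1 - p) * (β - α) ^ p) ≤ a * ((c * t) ^ (1 - p) * (β - α) ^ p) := by
      apply mul_le_mul_of_nonneg_right hab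
      have : 0 ≤ β - α := by linarith
      positivity
    nlinarith
  have h6 := mul_le_mul_of_nonneg_left h5 (show 0 ≤ (a - b) ^ (p - 1) by positivity)
  refine le_trans (le_of_eq ?_) h6
  rw [← hat, Real.mul_rpow ha ht0.le, Real.mul_rpow hc0.le ht0.le]
  have e1 : t ^ (p - 1) * t ^ (1 - p) = 1 := by
    rw [← Real.rpow_add ht0]; simp
  have e2 : a ^ (p - 1) * a = a ^ p := by
    rw [← Real.rpow_add_one ha0.ne']; simp
  rw [← e2]
  linear_combination -(c ^ (1 - p) * (a ^ (p-1) * a) * (β - α) ^ p) * (-e1)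

lemma Lf_swap (p a b : ℝ) : Lf p a b = - Lf p b a := by
  unfold Lf; rw [abs_sub_comm]; ring

lemma Lf_neg (p a b : ℝ) : Lf p (-a) (-b) = - Lf p a b := by
  unfold Lf; rw [show -a - -b = -(a - b) by ring, abs_neg]; ring

lemma Lf_of_le {p a b : ℝ} (hp : 1 < p) (h : b ≤ a) : Lf p a b = (a - b) ^ (p - 1) := by
  unfold Lf
  rcases h.eq_or_lt with h | h
  · subst h; simp [Real.zero_rpow (show p - 1 ≠ 0 by linarith)]
  · rw [abs_of_pos (by linarith), ← Real.rpow_add_one (by linarith)]; ring_nf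

lemma Lf_abs {p a b : ℝ} (hp : 1 < p) : |Lf p a b| = |a - b| ^ (p - 1) := by
  rcases le_total b a with h | h
  · rw [Lf_of_le hp h, abs_of_nonneg (Real.rpow_nonneg (by linarith) _),
      abs_of_nonneg (by linarith : 0 ≤ a - b)]
  · rw [Lf_swap, Lf_of_le hp h, abs_neg, abs_of_nonneg (Real.rpow_nonneg (by linarith) _),
      abs_of_nonpos (by linarith : a - b ≤ 0)]; ring_nf

/-- positive part above level k -/
noncomputable def pk (k t : ℝ) : ℝ := max (t - k) 0

lemma pk_nonneg (k t : ℝ) : 0 ≤ pk k t := le_max_right _ _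
lemma pk_of_le {k t : ℝ} (h : t ≤ k) : pk k t = 0 := by unfold pk; rw [max_eq_right]; linarith
lemma pk_of_ge {k t : ℝ} (h : k ≤ t) : pk k t = t - k := by unfold pk; rw [max_eq_left]; linarith

lemma pw1 {p : ℝ} (hp : 1 < p) (k x y : ℝ) {α β : ℝ} (hα : 0 ≤ α) (hβ : 0 ≤ β) :
    (if y ≤ k then α ^ p * pk k x ^ p else 0)
      - (min 1 (1 / (p - 1))) ^ (1 - p) * (pk k x ^ p + pk k y ^ p) * |α - β| ^ p
    ≤ Lf p x y * (α ^ p * pk k x - β ^ p * pk k y) := by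
  have hp1 : 0 < p - 1 := by linarith
  have hp0 : 0 < p := by linarith
  set c := min 1 (1 / (p - 1)) with hc
  have hc0 : 0 < c := by rw [hc]; positivity
  have hx := pk_nonneg k x
  have hy := pk_nonneg k y
  have hC : 0 ≤ c ^ (1 - p) * (pk k x ^ p + pk k y ^ p) * |α - β| ^ p := by positivity
  split_ifs with h
  · rw [pk_of_le h, mul_zero, sub_zero]
    rw [pk_of_le h] at hC
    rcases le_total x k with h2 | h2
    · rw [pk_of_le h2] at *; simp [Real.zero_rpow hp0.ne']
    · have h3 : pk k x ^ (p - 1) ≤ Lf p x y := by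
        rw [Lf_of_le hp (h.trans h2)]
        apply Real.rpow_le_rpow hx _ hp1.le
        rw [pk_of_ge h2]; linarith
      have h4 : pk k x ^ (p - 1) * (α ^ p * pk k x) = α ^ p * pk k x ^ p := by
        rcases hx.eq_or_lt with h0 | h0
        · rw [← h0]; simp [Real.zero_rpow hp0.ne']
        · conv_rhs => rw [show p = p - 1 + 1 by ring, Real.rpow_add_one h0.ne']
          ring_nf
      have h5 := mul_le_mul_of_nonneg_right h3 (show 0 ≤ α ^ p * pk k x by positivity)
      linarith
  · push Not at h
    rw [zero_sub]
    have hy' := pk_of_ge h.le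
    rcases le_total x y with h2 | h2
    · have h3 : pk k x ≤ pk k y := by unfold pk; gcongr
      have h6 := alg_aux hp hx h3 hβ hα
      have h4 : (pk k y - pk k x) ^ (p - 1) * (β ^ p * pk k y - α ^ p * pk k x) ≤
          Lf p x y * (α ^ p * pk k x - β ^ p * pk k y) := by
        rw [Lf_swap, Lf_of_le hp h2]
        rcases le_total x k with h5 | h5
        · rw [pk_of_le h5];
          have : (pk k y - 0) ^ (p - 1) ≤ (y - x) ^ (p - 1) := by
            apply Real.rpow_le_rpow (by linarith) _ hp1.le
            rw [hy']; linarith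
          have h7 := mul_le_mul_of_nonneg_right this (show 0 ≤ β ^ p * pk k y by positivity)
          linarith
        · rw [hy', pk_of_ge h5]; apply le_of_eq; ring_nf
      refine le_trans ?_ (h6.trans h4)
      rw [neg_le_neg_iff, abs_sub_comm β α]
      have : 0 ≤ pk k x ^ p := by positivity
      gcongr; linarith
    · have h3 : pk k y ≤ pk k x := by unfold pk; gcongr
      have h6 := alg_aux hp hy h3 hα hβ
      have h4 : (pk k x - pk k y) ^ (p - 1) * (α ^ p * pk k x - β ^ p * pk k y) ≤
          Lf p x y * (α ^ p * pk k x - β ^ p * pk k y) := by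
        rw [Lf_of_le hp h2, hy', pk_of_ge (h.le.trans h2)]; apply le_of_eq; ring_nf
      refine le_trans ?_ (h6.trans h4)
      rw [neg_le_neg_iff]
      have : 0 ≤ pk k y ^ p := by positivity
      gcongr; linarith

lemma pw2 {p : ℝ} (hp : 1 < p) {k : ℝ} (hk : 0 ≤ k) (x y : ℝ) {A : ℝ} (hA : 0 ≤ A) :
    -(|y| ^ (p - 1) * (A * pk k x)) ≤ Lf p x y * (A * pk k x) := by
  have hp1 : 0 < p - 1 := by linarith
  rcases le_total x k with h | h
  · simp [pk_of_le h]
  rw [← neg_mul]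
  apply mul_le_mul_of_nonneg_right _ (mul_nonneg hA (pk_nonneg _ _))
  rcases le_total y x with h2 | h2
  · rw [Lf_of_le hp h2]
    have h3 : 0 ≤ (x - y) ^ (p - 1) := Real.rpow_nonneg (by linarith) _
    have : 0 ≤ |y| ^ (p - 1) := by positivity
    linarith
  · rw [Lf_swap, Lf_of_le hp h2, neg_le_neg_iff]
    apply Real.rpow_le_rpow (by linarith) _ hp1.le
    have := le_abs_self y
    linarith

lemma rpow_lip {p : ℝ} (hp : 1 < p) {α β : ℝ} (hα : 0 ≤ α) (hβ : 0 ≤ β) (hα1 : α ≤ 1)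
    (hβ1 : β ≤ 1) : |α ^ p - β ^ p| ≤ p * |α - β| := by
  wlog h : β ≤ α generalizing α β
  · rw [abs_sub_comm, abs_sub_comm α]; exact this hβ hα hβ1 hα1 (by linarith)
  have hp0 : 0 < p := by linarith
  have h1 : β ^ p ≤ α ^ p := Real.rpow_le_rpow hβ h (by linarith)
  rw [abs_of_nonneg (by linarith), abs_of_nonneg (by linarith)]
  rcases hα.eq_or_lt with h0 | h0
  · subst h0
    have : β = 0 := by linarith
    subst this; simp
  have h2 := one_add_mul_self_le_rpow_one_add (s := β / α - 1) (by have : 0 ≤ β / α := by positivity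
                                                                   linarith) hp.le
  rw [add_sub_cancel, Real.div_rpow hβ hα] at h2
  have h3 : 0 < α ^ p := by positivity
  rw [le_div_iff₀ h3] at h2
  have h4 : α ^ p ≤ α := by
    simpa using Real.rpow_le_rpow_of_exponent_ge h0 hα1 hp.le
  have h5 : p * ((α - β) / α) * α ^ p ≤ p * ((α - β) / α) * α := by
    have : 0 ≤ α - β := by linarith
    gcongr
  have h6 : p * ((α - β) / α) * α = p * (α - β) := by field_simp
  have h7 : (1 + p * (β / α - 1)) * α ^ p = α ^ p - p * ((α - β) / α) * α ^ p := by
    field_simp; ring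
  linarith

lemma rpow_add_le' {p : ℝ} (hp : 1 < p) (a b : ℝ) :
    |a + b| ^ p ≤ 2 ^ p * (|a| ^ p + |b| ^ p) := by
  have hp0 : 0 < p := by linarith
  have h1 : |a + b| ≤ 2 * max |a| |b| := by
    have := abs_add_le a b
    have := le_max_left |a| |b|
    have := le_max_right |a| |b|
    linarith
  calc |a + b| ^ p ≤ (2 * max |a| |b|) ^ p := Real.rpow_le_rpow (abs_nonneg _) h1 hp0.le
    _ = 2 ^ p * (max |a| |b|) ^ p := by rw [Real.mul_rpow] <;> positivity
    _ ≤ _ := by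
      gcongr
      have h2 : 0 ≤ |a| ^ p := by positivity
      have h3 : 0 ≤ |b| ^ p := by positivity
      rcases le_total |a| |b| with h | h
      · rw [max_eq_right h]; linarith
      · rw [max_eq_left h]; linarith

lemma young' {p : ℝ} (hp : 1 < p) {a b : ℝ} (ha : 0 ≤ a) (hb : 0 ≤ b) :
    a ^ (p - 1) * b ≤ a ^ p + b ^ p := by
  have hp0 : 0 < p := by linarith
  have key : ∀ m : ℝ, 0 ≤ m → m ^ (p - 1) * m = m ^ p := by
    intro m hm
    rcases hm.eq_or_lt with h | h
    · rw [← h]; simp [Real.zero_rpow hp0.ne']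
    · rw [← Real.rpow_add_one h.ne']; simp
  have h2 : 0 ≤ a ^ p := by positivity
  have h3 : 0 ≤ b ^ p := by positivity
  rcases le_total a b with h | h
  · have : a ^ (p - 1) * b ≤ b ^ (p - 1) * b := by gcongr
    rw [key b hb] at this; linarith
  · have : a ^ (p - 1) * b ≤ a ^ (p - 1) * a := by gcongr
    rw [key a ha] at this; linarith

/-- truncated Riesz-type kernel -/
noncomputable def kap (n : ℕ) (s p D : ℝ) (z : Euc n) : ℝ :=
  (ball (0 : Euc n) D).indicator (fun z => ‖z‖ ^ (p - ((n : ℝ) + s * p))) z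

lemma kap_nonneg (n : ℕ) (s p D : ℝ) (z : Euc n) : 0 ≤ kap n s p D z := by
  unfold kap; apply Set.indicator_nonneg; intro x _; positivity

lemma kap_neg (n : ℕ) (s p D : ℝ) (z : Euc n) : kap n s p D (-z) = kap n s p D z := by
  unfold kap; simp [Set.indicator]

lemma kap_integrable {n : ℕ} {s p : ℝ} (D : ℝ) (hn : 1 ≤ n) (hs1 : s < 1) (hp : 1 < p) :
    Integrable (kap n s p D) := by
  unfold kap
  rw [show (fun z : Euc n => (ball (0 : Euc n) D).indicator (fun z => ‖z‖ ^ (p - ((n : ℝ) + s * p))) z)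
    = (ball (0 : Euc n) D).indicator (fun z => ‖z‖ ^ (p - ((n : ℝ) + s * p))) from rfl]
  rw [integrable_indicator_iff measurableSet_ball]
  refine integrableOn_ball_of_norm_le_rpow (C := 1) (α := (n : ℝ) + s * p - p) ?_ ?_ ?_ ?_
  · simpa using hn
  · simp; nlinarith
  · refine Eventually.of_forall fun x => ?_
    rw [Real.norm_of_nonneg (by positivity), one_mul]
    apply le_of_eq; congr 1; ring
  · exact (measurable_norm.pow_const _).aestronglyMeasurable

lemma conv_snd {n : ℕ} {f κ : Euc n → ℝ} (hf : Integrable f) (hκ : Integrable κ) :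
    Integrable (fun z : Euc n × Euc n => f z.2 * κ (z.1 - z.2)) (volume.prod volume) ∧
    ∫ z : Euc n × Euc n, f z.2 * κ (z.1 - z.2) ∂(volume.prod volume) = (∫ x, f x) * ∫ x, κ x := by
  have h := hf.convolution_integrand (ContinuousLinearMap.mul ℝ ℝ) hκ
  simp only [ContinuousLinearMap.mul_apply'] at h
  refine ⟨h, ?_⟩
  rw [integral_prod_symm _ h]
  simp_rw [integral_const_mul, integral_sub_right_eq_self κ, integral_mul_const]

lemma conv_fst {n : ℕ} {f κ : Euc n → ℝ} (hf : Integrable f) (hκ : Integrable κ)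
    (he : ∀ z, κ (-z) = κ z) :
    Integrable (fun z : Euc n × Euc n => f z.1 * κ (z.1 - z.2)) (volume.prod volume) ∧
    ∫ z : Euc n × Euc n, f z.1 * κ (z.1 - z.2) ∂(volume.prod volume) = (∫ x, f x) * ∫ x, κ x := by
  obtain ⟨h1, h2⟩ := conv_snd hf hκ
  have e : (fun z : Euc n × Euc n => f z.1 * κ (z.1 - z.2)) =
      (fun z : Euc n × Euc n => f z.2 * κ (z.1 - z.2)) ∘ Prod.swap := by
    funext z; simp only [Function.comp, Prod.fst_swap, Prod.snd_swap]
    rw [← he, neg_sub]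
  refine ⟨by rw [e]; exact h1.swap, ?_⟩
  rw [← h2, ← integral_prod_swap]
  exact integral_congr_ae (Eventually.of_forall fun z => by
    simp only [Prod.fst_swap, Prod.snd_swap]
    rw [← he, neg_sub])

lemma conv_fst_restrict {n : ℕ} {f κ : Euc n → ℝ} (hf : Integrable f) (hκ : Integrable κ)
    (he : ∀ z, κ (-z) = κ z) (hf0 : ∀ x, 0 ≤ f x) (hκ0 : ∀ x, 0 ≤ κ x) (S : Set (Euc n)) :
    Integrable (fun z : Euc n × Euc n => f z.1 * κ (z.1 - z.2))
      ((volume.restrict S).prod (volume.restrict S)) ∧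
    ∫ z : Euc n × Euc n, f z.1 * κ (z.1 - z.2) ∂((volume.restrict S).prod (volume.restrict S))
      ≤ (∫ x, f x) * ∫ x, κ x := by
  obtain ⟨h1, h2⟩ := conv_fst hf hκ he
  rw [Measure.prod_restrict, ← h2]
  exact ⟨h1.integrableOn, setIntegral_le_integral h1
    (Eventually.of_forall fun z => mul_nonneg (hf0 _) (hκ0 _))⟩

lemma conv_snd_restrict {n : ℕ} {f κ : Euc n → ℝ} (hf : Integrable f) (hκ : Integrable κ)
    (hf0 : ∀ x, 0 ≤ f x) (hκ0 : ∀ x, 0 ≤ κ x) (S : Set (Euc n)) :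
    Integrable (fun z : Euc n × Euc n => f z.2 * κ (z.1 - z.2))
      ((volume.restrict S).prod (volume.restrict S)) ∧
    ∫ z : Euc n × Euc n, f z.2 * κ (z.1 - z.2) ∂((volume.restrict S).prod (volume.restrict S))
      ≤ (∫ x, f x) * ∫ x, κ x := by
  obtain ⟨h1, h2⟩ := conv_snd hf hκ
  rw [Measure.prod_restrict, ← h2]
  exact ⟨h1.integrableOn, setIntegral_le_integral h1
    (Eventually.of_forall fun z => mul_nonneg (hf0 _) (hκ0 _))⟩

lemma gag_meas {n : ℕ} {s p : ℝ} {D : Set (Euc n)} {v : Euc n → ℝ}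
    (hv : AEMeasurable v (volume.restrict D)) :
    AEStronglyMeasurable (fun q : Euc n × Euc n =>
      |v q.1 - v q.2| ^ p / ‖q.1 - q.2‖ ^ ((n : ℝ) + s * p))
      ((volume.restrict D).prod (volume.restrict D)) := by
  have h1 : AEMeasurable (fun q : Euc n × Euc n => |v q.1 - v q.2| ^ p)
      ((volume.restrict D).prod (volume.restrict D)) :=
    ((hv.comp_fst.sub hv.comp_snd).norm).pow_const p
  have h2 : Measurable (fun q : Euc n × Euc n => ‖q.1 - q.2‖ ^ ((n : ℝ) + s * p)) := by fun_prop
  exact (h1.div h2.aemeasurable).aestronglyMeasurable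

lemma MemW.neg' {n : ℕ} {s p : ℝ} {D : Set (Euc n)} {v : Euc n → ℝ} (hv : MemW n s p D v) :
    MemW n s p D (fun x => - v x) := by
  refine ⟨hv.1.neg, by simpa using hv.2.1, ?_⟩
  have : ∀ q : Euc n × Euc n, |-v q.1 - -v q.2| = |v q.1 - v q.2| := by
    intro q; rw [← abs_neg]; congr 1; ring
  simp_rw [this]; exact hv.2.2

lemma MemW.add' {n : ℕ} {s p : ℝ} (hp : 1 < p) {D : Set (Euc n)} {v w : Euc n → ℝ}
    (hv : MemW n s p D v) (hw : MemW n s p D w) :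
    MemW n s p D (fun x => v x + w x) := by
  have hm : AEMeasurable (fun x => v x + w x) (volume.restrict D) := hv.1.add hw.1
  refine ⟨hm, ?_, ?_⟩
  · refine Integrable.mono' ((hv.2.1.add hw.2.1).const_mul (2 ^ p)) (hm.norm.pow_const p).aestronglyMeasurable ?_
    refine Eventually.of_forall fun x => ?_
    rw [Real.norm_of_nonneg (by positivity)]
    exact rpow_add_le' hp _ _
  · refine Integrable.mono' ((hv.2.2.add hw.2.2).const_mul (2 ^ p)) (gag_meas (v := fun x => v x + w x) hm) ?_
    refine Eventually.of_forall fun x => ?_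
    rw [Real.norm_of_nonneg (by positivity)]
    simp only [Pi.add_apply]
    rw [← add_div, ← mul_div_assoc]
    gcongr
    rw [show v x.1 + w x.1 - (v x.2 + w x.2) = (v x.1 - v x.2) + (w x.1 - w x.2) by ring]
    exact rpow_add_le' hp _ _

lemma pk_lip (k x y : ℝ) : |pk k x - pk k y| ≤ |x - y| := by
  unfold pk
  have := abs_max_sub_max_le_abs (x - k) (y - k) 0
  simpa using this

lemma pk_le_abs {k : ℝ} (hk : 0 ≤ k) (x : ℝ) : pk k x ≤ |x| := by
  unfold pk
  exact max_le (by have := le_abs_self x; linarith) (abs_nonneg _)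

lemma kap_bound {n : ℕ} {s p D t L : ℝ} (hp : 1 < p) {z : Euc n} (hz : ‖z‖ < D) (ht0 : 0 ≤ t)
    (hL : 0 ≤ L) (ht : t ≤ L * ‖z‖) :
    t ^ p / ‖z‖ ^ ((n : ℝ) + s * p) ≤ L ^ p * kap n s p D z := by
  have hk := kap_nonneg n s p D z
  have hp0 : 0 < p := by linarith
  rcases (norm_nonneg z).eq_or_lt with h | h
  · have : t = 0 := by rw [← h] at ht; linarith
    rw [this, Real.zero_rpow hp0.ne', zero_div]; positivity
  · unfold kap
    rw [Set.indicator_of_mem (by simpa using hz), Real.rpow_sub h, ← mul_div_assoc,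
      ← Real.mul_rpow hL h.le]
    gcongr

/-- admissible cutoff data -/
structure Cut (n : ℕ) (x₀ : Euc n) (r L : ℝ) (φ : Euc n → ℝ) : Prop where
  L0 : 0 ≤ L
  lip : ∀ x y, |φ x - φ y| ≤ L * ‖x - y‖
  nonneg : ∀ x, 0 ≤ φ x
  le_one : ∀ x, φ x ≤ 1
  zero : ∀ x, x ∉ ball x₀ r → φ x = 0

lemma Cut.cont {n : ℕ} {x₀ : Euc n} {r L : ℝ} {φ : Euc n → ℝ} (h : Cut n x₀ r L φ) :
    Continuous φ := by
  have : LipschitzWith ⟨L, h.L0⟩ φ := LipschitzWith.of_dist_le_mul fun x y => by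
    rw [Real.dist_eq, dist_eq_norm]; exact h.lip x y
  exact this.continuous

lemma Cut.rpow_le_one {n : ℕ} {x₀ : Euc n} {r L p : ℝ} {φ : Euc n → ℝ} (h : Cut n x₀ r L φ)
    (hp : 1 < p) (x : Euc n) : φ x ^ p ≤ 1 :=
  Real.rpow_le_one (h.nonneg x) (h.le_one x) (by linarith)

lemma psi_memW {n : ℕ} {s p : ℝ} (hn : 1 ≤ n) (hs1 : s < 1) (hp : 1 < p) {D : Set (Euc n)}
    (hDo : IsOpen D) (hDb : Bornology.IsBounded D)
    {w : Euc n → ℝ} (hw : MemW n s p D w) {x₀ : Euc n} {r L : ℝ} {φ : Euc n → ℝ}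
    (hφ : Cut n x₀ r L φ) {k : ℝ} (hk : 0 ≤ k) :
    MemW n s p D (fun x => φ x ^ p * pk k (w x)) := by
  have hp0 : 0 < p := by linarith
  have hpm : Measurable (pk k) := by unfold pk; fun_prop
  have hφm : Measurable φ := hφ.cont.measurable
  have hm : AEMeasurable (fun x => φ x ^ p * pk k (w x)) (volume.restrict D) :=
    ((hφm.pow_const p).aemeasurable).mul (hpm.comp_aemeasurable hw.1)
  obtain ⟨R, hR⟩ := hDb.subset_ball (0 : Euc n)
  refine ⟨hm, ?_, ?_⟩
  · refine Integrable.mono' hw.2.1 (hm.norm.pow_const p).aestronglyMeasurable ?_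
    refine Eventually.of_forall fun x => ?_
    rw [Real.norm_of_nonneg (by positivity)]
    apply Real.rpow_le_rpow (abs_nonneg _) _ hp0.le
    rw [abs_of_nonneg (mul_nonneg (Real.rpow_nonneg (hφ.nonneg x) _) (pk_nonneg _ _))]
    calc _ ≤ 1 * pk k (w x) := by
          apply mul_le_mul_of_nonneg_right (hφ.rpow_le_one hp x) (pk_nonneg _ _)
      _ ≤ _ := by rw [one_mul]; exact pk_le_abs hk _
  · -- f = |w|^p indicator
    have hf : Integrable (D.indicator (fun x => |w x| ^ p)) :=
      (integrable_indicator_iff hDo.measurableSet).2 hw.2.1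
    have hf0 : ∀ x, 0 ≤ D.indicator (fun x => |w x| ^ p) x := by
      intro x; apply Set.indicator_nonneg; intro x _; positivity
    have hκ := kap_integrable (n := n) (s := s) (p := p) (R + R) hn hs1 hp
    have hc := (conv_fst_restrict hf hκ (kap_neg n s p (R + R)) hf0 (kap_nonneg n s p (R+R)) D).1
    refine Integrable.mono' ((hw.2.2.add (hc.const_mul ((p * L) ^ p))).const_mul (2 ^ p))
      (gag_meas (v := fun x => φ x ^ p * pk k (w x)) hm) ?_
    rw [Measure.prod_restrict]
    refine (ae_restrict_iff' (hDo.measurableSet.prod hDo.measurableSet)).2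
      (Eventually.of_forall fun q hq => ?_)
    obtain ⟨hq1, hq2⟩ := hq
    rw [Real.norm_of_nonneg (by positivity)]
    simp only [Pi.add_apply, Set.indicator_of_mem hq1]
    have hpL : 0 ≤ p * L := mul_nonneg hp0.le hφ.L0
    have hz : ‖q.1 - q.2‖ < R + R := by
      have h1 := hR hq1
      have h2 := hR hq2
      rw [mem_ball_zero_iff] at h1 h2
      exact (norm_sub_le _ _).trans_lt (by linarith)
    have e1 : φ q.1 ^ p * pk k (w q.1) - φ q.2 ^ p * pk k (w q.2) =
      φ q.2 ^ p * (pk k (w q.1) - pk k (w q.2)) + pk k (w q.1) * (φ q.1 ^ p - φ q.2 ^ p) := by ring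
    rw [e1]
    have e2 := rpow_add_le' hp (φ q.2 ^ p * (pk k (w q.1) - pk k (w q.2)))
      (pk k (w q.1) * (φ q.1 ^ p - φ q.2 ^ p))
    have e3 : |φ q.2 ^ p * (pk k (w q.1) - pk k (w q.2))| ^ p ≤ |w q.1 - w q.2| ^ p := by
      apply Real.rpow_le_rpow (abs_nonneg _) _ hp0.le
      rw [abs_mul, abs_of_nonneg (Real.rpow_nonneg (hφ.nonneg _) _)]
      calc _ ≤ 1 * |pk k (w q.1) - pk k (w q.2)| :=
            mul_le_mul_of_nonneg_right (hφ.rpow_le_one hp _) (abs_nonneg _)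
        _ ≤ _ := by rw [one_mul]; exact pk_lip _ _ _
    have e4 : |pk k (w q.1) * (φ q.1 ^ p - φ q.2 ^ p)| ^ p ≤ |w q.1| ^ p * |φ q.1 ^ p - φ q.2 ^ p| ^ p := by
      rw [abs_mul, Real.mul_rpow (abs_nonneg _) (abs_nonneg _), abs_of_nonneg (pk_nonneg _ _)]
      apply mul_le_mul_of_nonneg_right _ (by positivity)
      exact Real.rpow_le_rpow (pk_nonneg _ _) (pk_le_abs hk _) hp0.le
    have e5 : |φ q.1 ^ p - φ q.2 ^ p| ≤ p * L * ‖q.1 - q.2‖ := by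
      refine (rpow_lip hp (hφ.nonneg _) (hφ.nonneg _) (hφ.le_one _) (hφ.le_one _)).trans ?_
      rw [mul_assoc]; exact mul_le_mul_of_nonneg_left (hφ.lip _ _) hp0.le
    have e6 := kap_bound (s := s) hp hz (abs_nonneg _) hpL e5
    calc _ ≤ 2 ^ p * (|w q.1 - w q.2| ^ p + |w q.1| ^ p * |φ q.1 ^ p - φ q.2 ^ p| ^ p) /
          ‖q.1 - q.2‖ ^ ((n : ℝ) + s * p) := by
            apply div_le_div_of_nonneg_right _ (by positivity)
            refine e2.trans ?_
            gcongr
      _ = 2 ^ p * (|w q.1 - w q.2| ^ p / ‖q.1 - q.2‖ ^ ((n : ℝ) + s * p)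
          + |w q.1| ^ p * (|φ q.1 ^ p - φ q.2 ^ p| ^ p / ‖q.1 - q.2‖ ^ ((n : ℝ) + s * p))) := by
            rw [mul_div_assoc, add_div, mul_div_assoc]
      _ ≤ 2 ^ p * (|w q.1 - w q.2| ^ p / ‖q.1 - q.2‖ ^ ((n : ℝ) + s * p)
          + |w q.1| ^ p * ((p * L) ^ p * kap n s p (R + R) (q.1 - q.2))) := by
            gcongr
      _ = _ := by ring

lemma kernel_ae {n : ℕ} {s p Λ : ℝ} (hn : 1 ≤ n) (hs0 : 0 < s) (hp : 1 < p) (hΛ : 1 ≤ Λ)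
    {K : Euc n → Euc n → ℝ} (hK : IsKernel n s p Λ K) :
    ∀ᵐ z : Euc n × Euc n ∂(volume.prod volume), 0 < ‖z.1 - z.2‖ ∧
      Λ⁻¹ / ‖z.1 - z.2‖ ^ ((n : ℝ) + s * p) ≤ K z.1 z.2 ∧
      K z.1 z.2 ≤ Λ / ‖z.1 - z.2‖ ^ ((n : ℝ) + s * p) := by
  have hσ : 0 < (n : ℝ) + s * p := by positivity
  rw [← Measure.volume_eq_prod]
  filter_upwards [hK.2.2.2] with z hz
  have h0 : 0 < ‖z.1 - z.2‖ := by
    rcases (norm_nonneg (z.1 - z.2)).eq_or_lt with h | h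
    · rw [← h, Real.zero_rpow hσ.ne', mul_zero] at hz
      have : 0 < Λ⁻¹ := by positivity
      linarith [hz.1]
    · exact h
  have h1 : 0 < ‖z.1 - z.2‖ ^ ((n : ℝ) + s * p) := by positivity
  exact ⟨h0, by rw [div_le_iff₀ h1]; exact hz.1, by rw [le_div_iff₀ h1]; exact hz.2⟩

lemma Lf_meas (p : ℝ) : Measurable (fun z : ℝ × ℝ => Lf p z.1 z.2) := by
  unfold Lf; fun_prop

lemma F_integrable {n : ℕ} {s p Λ : ℝ} (hn : 1 ≤ n) (hs0 : 0 < s) (hp : 1 < p) (hΛ : 1 ≤ Λ)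
    {K : Euc n → Euc n → ℝ} (hK : IsKernel n s p Λ K) {D : Set (Euc n)}
    {w ψ : Euc n → ℝ} (hw : MemW n s p D w) (hψ : MemW n s p D ψ) :
    Integrable (fun z : Euc n × Euc n => Lf p (w z.1) (w z.2) * (ψ z.1 - ψ z.2) * K z.1 z.2)
      ((volume.restrict D).prod (volume.restrict D)) := by
  have hLm : AEMeasurable (fun z : Euc n × Euc n => Lf p (w z.1) (w z.2))
      ((volume.restrict D).prod (volume.restrict D)) :=
    (Lf_meas p).comp_aemeasurable (hw.1.comp_fst.prodMk hw.1.comp_snd)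
  have hKm : Measurable (fun z : Euc n × Euc n => K z.1 z.2) := hK.1
  have hm := ((hLm.mul (hψ.1.comp_fst.sub hψ.1.comp_snd)).mul hKm.aemeasurable).aestronglyMeasurable
  refine Integrable.mono' ((hw.2.2.add hψ.2.2).const_mul Λ) hm ?_
  have hae := kernel_ae hn hs0 hp hΛ hK
  have hae' := ae_restrict_of_ae (s := D ×ˢ D) hae
  rw [← Measure.prod_restrict] at hae'
  filter_upwards [hae'] with z hz
  obtain ⟨h0, -, h2⟩ := hz
  simp only [Pi.add_apply, Pi.mul_apply, Pi.sub_apply]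
  rw [norm_mul, norm_mul, Real.norm_eq_abs, Real.norm_eq_abs, Real.norm_eq_abs, Lf_abs hp,
    abs_of_nonneg (hK.2.2.1 _ _)]
  have h3 := young' hp (abs_nonneg (w z.1 - w z.2)) (abs_nonneg (ψ z.1 - ψ z.2))
  calc _ ≤ (|w z.1 - w z.2| ^ p + |ψ z.1 - ψ z.2| ^ p) * (Λ / ‖z.1 - z.2‖ ^ ((n : ℝ) + s * p)) := by
        apply mul_le_mul h3 h2 (hK.2.2.1 _ _) (by positivity)
    _ = _ := by ring

lemma pointwise_bound {n : ℕ} {s p Λ : ℝ} (hn : 1 ≤ n) (hs0 : 0 < s) (hp : 1 < p) (hΛ : 1 ≤ Λ)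
    {K : Euc n → Euc n → ℝ} (hK : IsKernel n s p Λ K)
    {w φ : Euc n → ℝ} {x₀ : Euc n} {ρ' ρ L k R D : ℝ} (hφ : Cut n x₀ ρ L φ) (hL : 0 < L)
    (hρ : ρ' ≤ ρ)
    (hφ1 : ∀ x ∈ ball x₀ ρ', φ x = 1) (hφ0 : ∀ x, φ x ≠ 0 → ‖x - x₀‖ ≤ ρ - 1 / L)
    (hk : 0 ≤ k) (hR : 0 < R) {x y : Euc n} (hxy : 0 < ‖x - y‖) (hD : ‖x - y‖ < D)
    (hK1 : Λ⁻¹ / ‖x - y‖ ^ ((n : ℝ) + s * p) ≤ K x y)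
    (hK2 : K x y ≤ Λ / ‖x - y‖ ^ ((n : ℝ) + s * p)) :
    Λ⁻¹ / R ^ ((n : ℝ) + s * p) * ((ball x₀ ρ').indicator (fun x => pk k (w x) ^ p) x *
      ((ball x₀ ρ).indicator 1 y * (Set.Iic k).indicator 1 (w y) * (ball 0 R).indicator 1 (x - y)))
    - ((min 1 (1 / (p - 1))) ^ (1 - p) * Λ * L ^ p *
        ((ball x₀ ρ).indicator (fun x => pk k (w x) ^ p) x * kap n s p D (x - y) +
         (ball x₀ ρ).indicator (fun x => pk k (w x) ^ p) y * kap n s p D (x - y))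
      + Λ * L ^ ((n : ℝ) + s * p) * ((ball x₀ ρ).indicator (fun x => pk k (w x)) x * |w y| ^ (p - 1)
        + |w x| ^ (p - 1) * (ball x₀ ρ).indicator (fun x => pk k (w x)) y))
    ≤ Lf p (w x) (w y) * (φ x ^ p * pk k (w x) - φ y ^ p * pk k (w y)) * K x y := by
  have hp0 : 0 < p := by linarith
  have hp1 : 0 < p - 1 := by linarith
  set σ := (n : ℝ) + s * p with hσd
  have hσ : 0 < σ := by positivity
  set c := (min 1 (1 / (p - 1))) ^ (1 - p) with hc
  have hc0 : 0 ≤ c := by rw [hc]; positivity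
  have hΛ0 : 0 < Λ := by linarith
  have hKn := hK.2.2.1 x y
  have hpx := pk_nonneg k (w x)
  have hpy := pk_nonneg k (w y)
  have hkap := kap_nonneg n s p D (x - y)
  -- far bound
  have far : ∀ x' y' : Euc n, ‖x' - y'‖ = ‖x - y‖ → y' ∉ ball x₀ ρ →
      φ x' ^ p * K x y ≤ Λ * L ^ σ := by
    intro x' y' hn' hy'
    by_cases h0 : φ x' = 0
    · rw [h0, Real.zero_rpow hp0.ne', zero_mul]; positivity
    have h1 := hφ0 x' h0
    have h2 : ρ ≤ ‖y' - x₀‖ := by simpa [dist_eq_norm] using hy'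
    have h3 : 1 / L ≤ ‖x - y‖ := by
      rw [← hn']
      have : ‖y' - x₀‖ ≤ ‖x' - x₀‖ + ‖x' - y'‖ := by
        rw [show y' - x₀ = (x' - x₀) - (x' - y') by abel]; exact norm_sub_le _ _
      linarith
    have h4 : Λ / ‖x - y‖ ^ σ ≤ Λ * L ^ σ := by
      rw [div_le_iff₀ (by positivity), mul_assoc, ← Real.mul_rpow hL.le hxy.le]
      have : 1 ≤ (L * ‖x - y‖) ^ σ := by
        apply Real.one_le_rpow _ hσ.le
        rw [div_le_iff₀ hL] at h3; linarith
      nlinarith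
    calc φ x' ^ p * K x y ≤ 1 * K x y := mul_le_mul_of_nonneg_right (hφ.rpow_le_one hp _) hKn
      _ ≤ _ := by rw [one_mul]; exact hK2.trans h4
  have hsub : ball x₀ ρ' ⊆ ball x₀ ρ := ball_subset_ball hρ
  by_cases hx : x ∈ ball x₀ ρ <;> by_cases hy : y ∈ ball x₀ ρ
  · -- both in
    simp only [Set.indicator_of_mem hx, Set.indicator_of_mem hy, Pi.one_apply, one_mul]
    have h1 := pw1 hp k (w x) (w y) (hφ.nonneg x) (hφ.nonneg y)
    have h2 := mul_le_mul_of_nonneg_right h1 hKn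
    refine le_trans ?_ h2
    rw [sub_mul]
    have t1 : Λ⁻¹ / R ^ σ * ((ball x₀ ρ').indicator (fun x => pk k (w x) ^ p) x *
      ((Set.Iic k).indicator 1 (w y) * (ball 0 R).indicator 1 (x - y))) ≤
        (if w y ≤ k then φ x ^ p * pk k (w x) ^ p else 0) * K x y := by
      by_cases hx' : x ∈ ball x₀ ρ'
      · rw [Set.indicator_of_mem hx', hφ1 x hx', Real.one_rpow, one_mul]
        by_cases hwy : w y ≤ k
        · rw [if_pos hwy, Set.indicator_of_mem (show w y ∈ Set.Iic k from hwy), Pi.one_apply, one_mul]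
          by_cases hxyR : x - y ∈ ball (0 : Euc n) R
          · rw [Set.indicator_of_mem hxyR, Pi.one_apply, mul_one, mul_comm]
            apply mul_le_mul_of_nonneg_left _ (by positivity)
            refine le_trans ?_ hK1
            rw [mem_ball_zero_iff] at hxyR
            gcongr
          · rw [Set.indicator_of_notMem hxyR, mul_zero, mul_zero]; positivity
        · rw [if_neg hwy, Set.indicator_of_notMem (by simpa using hwy)]; simp
      · rw [Set.indicator_of_notMem hx', zero_mul, mul_zero]
        split_ifs
        · have := hφ.nonneg x; positivity
        · simp
    have t2 : c * (pk k (w x) ^ p + pk k (w y) ^ p) * |φ x - φ y| ^ p * K x y ≤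
        c * Λ * L ^ p * (pk k (w x) ^ p * kap n s p D (x - y) + pk k (w y) ^ p * kap n s p D (x - y)) := by
      have e1 := kap_bound (s := s) hp hD (abs_nonneg _) hL.le (hφ.lip x y)
      calc _ ≤ c * (pk k (w x) ^ p + pk k (w y) ^ p) * |φ x - φ y| ^ p * (Λ / ‖x - y‖ ^ σ) := by
            gcongr
        _ = c * (pk k (w x) ^ p + pk k (w y) ^ p) * Λ * (|φ x - φ y| ^ p / ‖x - y‖ ^ σ) := by ring
        _ ≤ c * (pk k (w x) ^ p + pk k (w y) ^ p) * Λ * (L ^ p * kap n s p D (x - y)) := by gcongr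
        _ = _ := by ring
    have t3 : 0 ≤ Λ * L ^ σ * (pk k (w x) * |w y| ^ (p - 1) + |w x| ^ (p - 1) * pk k (w y)) := by
      positivity
    linarith
  · -- x in, y out
    rw [hφ.zero y hy, Real.zero_rpow hp0.ne', zero_mul, sub_zero]
    simp only [Set.indicator_of_mem hx, Set.indicator_of_notMem hy, zero_mul, mul_zero, add_zero, zero_sub]
    have h1 := pw2 hp hk (w x) (w y) (Real.rpow_nonneg (hφ.nonneg x) p)
    have h2 := mul_le_mul_of_nonneg_right h1 hKn
    refine le_trans ?_ h2
    have h3 := mul_le_mul_of_nonneg_left (far x y rfl hy) (show 0 ≤ pk k (w x) * |w y| ^ (p-1) by positivity)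
    have h4 : 0 ≤ c * Λ * L ^ p * (pk k (w x) ^ p * kap n s p D (x - y)) := by positivity
    nlinarith
  · -- x out, y in
    rw [hφ.zero x hx, Real.zero_rpow hp0.ne', zero_mul, zero_sub]
    simp only [Set.indicator_of_mem hy, Set.indicator_of_notMem hx,
      Set.indicator_of_notMem (fun h => hx (hsub h)), zero_mul, mul_zero, zero_add, zero_sub]
    rw [Lf_swap, neg_mul_neg]
    have h1 := pw2 hp hk (w y) (w x) (Real.rpow_nonneg (hφ.nonneg y) p)
    have h2 := mul_le_mul_of_nonneg_right h1 hKn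
    refine le_trans ?_ h2
    have h3 := mul_le_mul_of_nonneg_left (far y x (norm_sub_rev _ _) hx) (show 0 ≤ pk k (w y) * |w x| ^ (p-1) by positivity)
    have h4 : 0 ≤ c * Λ * L ^ p * (pk k (w y) ^ p * kap n s p D (x - y)) := by positivity
    nlinarith
  · rw [hφ.zero x hx, hφ.zero y hy, Real.zero_rpow hp0.ne']
    simp [Set.indicator_of_notMem hx, Set.indicator_of_notMem hy]

lemma G_lower {n : ℕ} (hn : 1 ≤ n) {D : Set (Euc n)} (hDo : IsOpen D) (hDb : Bornology.IsBounded D)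
    {w f : Euc n → ℝ} (hw : AEMeasurable w (volume.restrict D)) {x₀ : Euc n} {ρ' ρ k R : ℝ}
    (hB : ball x₀ ρ ⊆ D) (hR : 0 < R) (hρ : ρ' + R ≤ ρ) (hf : Integrable f) (hf0 : ∀ x, 0 ≤ f x)
    (hfs : ∀ x, x ∉ ball x₀ ρ' → f x = 0)
    (hm : ∫ y in ball x₀ ρ, (Set.Ioi k).indicator (1 : ℝ → ℝ) (w y) ≤
      (volume : Measure (Euc n)).real (ball 0 1) * R ^ n / 2) :
    Integrable (fun z : Euc n × Euc n => f z.1 * ((ball x₀ ρ).indicator (1 : Euc n → ℝ) z.2 *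
      (Set.Iic k).indicator (1 : ℝ → ℝ) (w z.2) * (ball (0 : Euc n) R).indicator 1 (z.1 - z.2)))
      ((volume.restrict D).prod (volume.restrict D)) ∧
    (volume : Measure (Euc n)).real (ball 0 1) * R ^ n / 2 * ∫ x, f x ≤
      ∫ z : Euc n × Euc n, f z.1 * ((ball x₀ ρ).indicator (1 : Euc n → ℝ) z.2 *
      (Set.Iic k).indicator (1 : ℝ → ℝ) (w z.2) * (ball (0 : Euc n) R).indicator 1 (z.1 - z.2))
      ∂((volume.restrict D).prod (volume.restrict D)) := by
  have hfin : IsFiniteMeasure ((volume : Measure (Euc n)).restrict D) :=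
    ⟨by rw [Measure.restrict_apply_univ]; exact hDb.measure_lt_top⟩
  have : Nontrivial (Euc n) := by
    apply Module.nontrivial_of_finrank_pos (R := ℝ); simp; omega
  have one0 : ∀ {α : Type} (s : Set α) (x : α), 0 ≤ s.indicator (1 : α → ℝ) x := fun s x =>
    Set.indicator_nonneg (fun _ _ => zero_le_one) x
  have one1 : ∀ {α : Type} (s : Set α) (x : α), s.indicator (1 : α → ℝ) x ≤ 1 := fun s x =>
    Set.indicator_le_self' (fun _ _ => zero_le_one) x
  have m1 : Measurable ((ball x₀ ρ).indicator (1 : Euc n → ℝ)) := measurable_one.indicator measurableSet_ball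
  have m2 : Measurable ((Set.Iic k).indicator (1 : ℝ → ℝ)) := measurable_one.indicator measurableSet_Iic
  have m2' : Measurable ((Set.Ioi k).indicator (1 : ℝ → ℝ)) := measurable_one.indicator measurableSet_Ioi
  have m3 : Measurable ((ball (0 : Euc n) R).indicator (1 : Euc n → ℝ)) := measurable_one.indicator measurableSet_ball
  have hSm : AEStronglyMeasurable (fun z : Euc n × Euc n => (ball x₀ ρ).indicator (1 : Euc n → ℝ) z.2 *
      (Set.Iic k).indicator (1 : ℝ → ℝ) (w z.2) * (ball (0 : Euc n) R).indicator (1 : Euc n → ℝ) (z.1 - z.2))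
      ((volume.restrict D).prod (volume.restrict D)) := by
    refine AEMeasurable.aestronglyMeasurable ?_
    refine AEMeasurable.mul (AEMeasurable.mul (m1.comp measurable_snd).aemeasurable ?_) ?_
    · exact m2.comp_aemeasurable hw.comp_snd
    · exact (m3.comp (measurable_fst.sub measurable_snd)).aemeasurable
  have hIntg : Integrable (fun z : Euc n × Euc n => f z.1 * ((ball x₀ ρ).indicator (1 : Euc n → ℝ) z.2 *
      (Set.Iic k).indicator (1 : ℝ → ℝ) (w z.2) * (ball (0 : Euc n) R).indicator (1 : Euc n → ℝ) (z.1 - z.2)))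
      ((volume.restrict D).prod (volume.restrict D)) := by
    have hfi : Integrable (fun z : Euc n × Euc n => f z.1) ((volume.restrict D).prod (volume.restrict D)) :=
      (hf.integrableOn (s := D)).comp_fst _
    refine Integrable.mono' hfi (hfi.aestronglyMeasurable.mul hSm) (Eventually.of_forall fun z => ?_)
    rw [Real.norm_of_nonneg (by have := hf0 z.1; have := one0 (ball x₀ ρ) z.2
                                have := one0 (Set.Iic k) (w z.2)
                                have := one0 (ball (0 : Euc n) R) (z.1 - z.2); positivity)]
    refine mul_le_of_le_one_right (hf0 _) ?_
    exact mul_le_one₀ (mul_le_one₀ (one1 _ _) (one0 _ _) (one1 _ _)) (one0 _ _) (one1 _ _)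
  refine ⟨hIntg, ?_⟩
  rw [integral_prod _ hIntg]
  have hfD : ∫ x, f x = ∫ x in D, f x := by
    refine (setIntegral_eq_integral_of_forall_compl_eq_zero fun x hx => hfs x fun h => hx ?_).symm
    exact hB (ball_subset_ball (by linarith) h)
  rw [hfD, ← integral_const_mul]
  refine integral_mono (hf.integrableOn.const_mul _) hIntg.integral_prod_left ?_
  intro x
  simp only
  rw [integral_const_mul, mul_comm]
  by_cases hx : x ∈ ball x₀ ρ'
  swap
  · rw [hfs x hx, zero_mul, zero_mul]
  refine mul_le_mul_of_nonneg_left ?_ (hf0 x)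
  have hxR : ball x R ⊆ ball x₀ ρ := by
    apply ball_subset_ball'
    rw [mem_ball] at hx; linarith
  have hI1 : Integrable ((ball x R).indicator (1 : Euc n → ℝ)) (volume.restrict D) := by
    refine Integrable.mono' (integrable_const 1) (measurable_one.indicator measurableSet_ball).aestronglyMeasurable ?_
    exact Eventually.of_forall fun y => by rw [Real.norm_of_nonneg (one0 _ _)]; exact one1 _ _
  have hI2 : Integrable ((ball x₀ ρ).indicator (fun y => (Set.Ioi k).indicator (1 : ℝ → ℝ) (w y)))
      (volume.restrict D) := by
    refine Integrable.mono' (integrable_const 1)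
      ((m2'.comp_aemeasurable hw).indicator measurableSet_ball).aestronglyMeasurable ?_
    refine Eventually.of_forall fun y => ?_
    rw [Real.norm_of_nonneg (Set.indicator_nonneg (fun _ _ => one0 _ _) _)]
    by_cases hy : y ∈ ball x₀ ρ
    · rw [Set.indicator_of_mem hy]; exact one1 _ _
    · rw [Set.indicator_of_notMem hy]; exact zero_le_one
  have e1 : ∫ y in D, (ball x R).indicator (1 : Euc n → ℝ) y =
      (volume : Measure (Euc n)).real (ball 0 1) * R ^ n := by
    rw [setIntegral_indicator measurableSet_ball, Set.inter_eq_right.2 (hxR.trans hB)]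
    simp only [Pi.one_apply, integral_const, smul_eq_mul, mul_one, measureReal_restrict_apply_univ]
    rw [measureReal_def, Measure.addHaar_ball _ _ hR.le, ENNReal.toReal_mul,
      ENNReal.toReal_ofReal (by positivity), mul_comm, measureReal_def]
    simp
  have e2 : ∫ y in D, (ball x₀ ρ).indicator (fun y => (Set.Ioi k).indicator (1 : ℝ → ℝ) (w y)) y =
      ∫ y in ball x₀ ρ, (Set.Ioi k).indicator (1 : ℝ → ℝ) (w y) := by
    rw [setIntegral_indicator measurableSet_ball, Set.inter_eq_right.2 hB]
  have e3 : ∫ y in D, ((ball x R).indicator (1 : Euc n → ℝ) y -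
      (ball x₀ ρ).indicator (fun y => (Set.Ioi k).indicator (1 : ℝ → ℝ) (w y)) y) ≤
      ∫ y in D, (ball x₀ ρ).indicator (1 : Euc n → ℝ) y *
      (Set.Iic k).indicator (1 : ℝ → ℝ) (w y) * (ball (0 : Euc n) R).indicator (1 : Euc n → ℝ) (x - y) := by
    refine integral_mono (hI1.sub hI2) ?_ ?_
    · refine Integrable.mono' (integrable_const 1) ?_ (Eventually.of_forall fun y => ?_)
      · refine AEMeasurable.aestronglyMeasurable ?_
        refine AEMeasurable.mul (AEMeasurable.mul m1.aemeasurable (m2.comp_aemeasurable hw)) ?_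
        exact (m3.comp (measurable_const.sub measurable_id)).aemeasurable
      · rw [Real.norm_of_nonneg (by have := one0 (ball x₀ ρ) y
                                    have := one0 (Set.Iic k) (w y)
                                    have := one0 (ball (0 : Euc n) R) (x - y); positivity)]
        exact mul_le_one₀ (mul_le_one₀ (one1 _ _) (one0 _ _) (one1 _ _)) (one0 _ _) (one1 _ _)
    · intro y
      simp only
      by_cases hy : y ∈ ball x R
      · have hy2 := hxR hy
        have hy3 : x - y ∈ ball (0 : Euc n) R := by
          rw [mem_ball_zero_iff, norm_sub_rev, ← dist_eq_norm]; exact hy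
        rw [Set.indicator_of_mem hy, Set.indicator_of_mem hy2, Set.indicator_of_mem hy2,
          Set.indicator_of_mem hy3]
        by_cases hk : w y ≤ k
        · rw [Set.indicator_of_notMem (by simpa using hk), Set.indicator_of_mem (by simpa using hk)]
          simp
        · rw [Set.indicator_of_mem (by simpa using hk), Set.indicator_of_notMem (by simpa using hk)]
          simp
      · rw [Set.indicator_of_notMem hy]
        have a1 : 0 ≤ (ball x₀ ρ).indicator (fun y => (Set.Ioi k).indicator (1 : ℝ → ℝ) (w y)) y :=
          Set.indicator_nonneg (fun _ _ => one0 _ _) _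
        have := one0 (ball x₀ ρ) y
        have := one0 (Set.Iic k) (w y)
        have := one0 (ball (0 : Euc n) R) (x - y)
        have : 0 ≤ (ball x₀ ρ).indicator (1 : Euc n → ℝ) y *
          (Set.Iic k).indicator (1 : ℝ → ℝ) (w y) * (ball (0 : Euc n) R).indicator (1 : Euc n → ℝ) (x - y) := by
          positivity
        linarith
  rw [integral_sub hI1 hI2, e1, e2] at e3
  refine le_trans ?_ e3
  linarith

lemma rpow_sub_one_le {p : ℝ} (hp : 1 < p) {t : ℝ} (ht : 0 ≤ t) : t ^ (p - 1) ≤ 1 + t ^ p := by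
  have := young' hp ht zero_le_one
  rw [mul_one, Real.one_rpow] at this; linarith

lemma le_one_add_rpow {p : ℝ} (hp : 1 < p) {t : ℝ} (ht : 0 ≤ t) : t ≤ 1 + t ^ p := by
  have := young' hp zero_le_one ht
  rw [Real.one_rpow, Real.one_rpow, one_mul] at this; linarith

lemma wpow_integrable {n : ℕ} {s p : ℝ} (hp : 1 < p) {D : Set (Euc n)}
    (hDb : Bornology.IsBounded D) {w : Euc n → ℝ} (hw : MemW n s p D w) :
    IntegrableOn (fun x => |w x| ^ (p - 1)) D := by
  have hfin : IsFiniteMeasure ((volume : Measure (Euc n)).restrict D) :=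
    ⟨by rw [Measure.restrict_apply_univ]; exact hDb.measure_lt_top⟩
  refine Integrable.mono' ((integrable_const (1 : ℝ)).add hw.2.1)
    (hw.1.norm.pow_const _).aestronglyMeasurable (Eventually.of_forall fun x => ?_)
  rw [Real.norm_of_nonneg (by positivity)]
  exact rpow_sub_one_le hp (abs_nonneg _)

lemma pk_meas (k : ℝ) : Measurable (pk k) := by unfold pk; fun_prop

lemma pkp_integrable {n : ℕ} {s p : ℝ} (hp : 1 < p) {D : Set (Euc n)}
    {w : Euc n → ℝ} (hw : MemW n s p D w) {k : ℝ} (hk : 0 ≤ k) :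
    IntegrableOn (fun x => pk k (w x) ^ p) D := by
  refine Integrable.mono' hw.2.1
    (((pk_meas k).comp_aemeasurable hw.1).pow_const p).aestronglyMeasurable (Eventually.of_forall fun x => ?_)
  have := pk_nonneg k (w x)
  rw [Real.norm_of_nonneg (by positivity)]
  exact Real.rpow_le_rpow this (pk_le_abs hk _) (by linarith)

lemma pk1_integrable {n : ℕ} {s p : ℝ} (hp : 1 < p) {D : Set (Euc n)}
    (hDb : Bornology.IsBounded D)
    {w : Euc n → ℝ} (hw : MemW n s p D w) {k : ℝ} (hk : 0 ≤ k) :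
    IntegrableOn (fun x => pk k (w x)) D := by
  have hfin : IsFiniteMeasure ((volume : Measure (Euc n)).restrict D) :=
    ⟨by rw [Measure.restrict_apply_univ]; exact hDb.measure_lt_top⟩
  refine Integrable.mono' ((integrable_const (1 : ℝ)).add hw.2.1)
    ((pk_meas k).comp_aemeasurable hw.1).aestronglyMeasurable (Eventually.of_forall fun x => ?_)
  have := pk_nonneg k (w x)
  rw [Real.norm_of_nonneg (by positivity)]
  exact (pk_le_abs hk _).trans (le_one_add_rpow hp (abs_nonneg _))

lemma int_lin {X : Type*} [MeasurableSpace X] {μ : Measure X} {G E1 E2 E3 E4 : X → ℝ} (α β γ : ℝ)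
    (h0 : Integrable G μ) (h1 : Integrable E1 μ) (h2 : Integrable E2 μ) (h3 : Integrable E3 μ)
    (h4 : Integrable E4 μ) :
    ∫ z, (α * G z - (β * (E1 z + E2 z) + γ * (E3 z + E4 z))) ∂μ =
      α * ∫ z, G z ∂μ - (β * (∫ z, E1 z ∂μ + ∫ z, E2 z ∂μ) + γ * (∫ z, E3 z ∂μ + ∫ z, E4 z ∂μ)) := by
  have h12 : Integrable (fun z => E1 z + E2 z) μ := h1.add h2
  have h34 : Integrable (fun z => E3 z + E4 z) μ := h3.add h4
  have hh : Integrable (fun z => β * (E1 z + E2 z) + γ * (E3 z + E4 z)) μ :=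
    (h12.const_mul β).add (h34.const_mul γ)
  rw [integral_sub (h0.const_mul α) hh, integral_add (h12.const_mul β) (h34.const_mul γ),
    integral_const_mul, integral_const_mul, integral_const_mul, integral_add h1 h2,
    integral_add h3 h4]

lemma I_lower {n : ℕ} {s p Λ : ℝ} (hn : 1 ≤ n) (hs0 : 0 < s) (hs1 : s < 1) (hp : 1 < p) (hΛ : 1 ≤ Λ)
    {K : Euc n → Euc n → ℝ} (hK : IsKernel n s p Λ K)
    {D : Set (Euc n)} (hDo : IsOpen D) (hDb : Bornology.IsBounded D) {R₁ : ℝ}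
    (hR₁ : D ⊆ ball 0 R₁)
    {w φ : Euc n → ℝ} (hw : MemW n s p D w)
    {x₀ : Euc n} {ρ' ρ L k R : ℝ} (hφ : Cut n x₀ ρ L φ) (hL : 0 < L)
    (hB : ball x₀ ρ ⊆ D) (hR : 0 < R) (hρ : ρ' + R ≤ ρ)
    (hφ1 : ∀ x ∈ ball x₀ ρ', φ x = 1) (hφ0 : ∀ x, φ x ≠ 0 → ‖x - x₀‖ ≤ ρ - 1 / L)
    (hk : 0 ≤ k)
    (hm : ∫ y in ball x₀ ρ, (Set.Ioi k).indicator (1 : ℝ → ℝ) (w y) ≤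
      (volume : Measure (Euc n)).real (ball 0 1) * R ^ n / 2) :
    Λ⁻¹ / R ^ ((n : ℝ) + s * p) * ((volume : Measure (Euc n)).real (ball 0 1) * R ^ n / 2 *
      ∫ x in ball x₀ ρ', pk k (w x) ^ p)
    - ((min 1 (1 / (p - 1))) ^ (1 - p) * Λ * L ^ p * (2 * ((∫ x in ball x₀ ρ, pk k (w x) ^ p) *
        ∫ z, kap n s p (R₁ + R₁) z))
      + Λ * L ^ ((n : ℝ) + s * p) * (2 * ((∫ x in ball x₀ ρ, pk k (w x)) * ∫ x in D, |w x| ^ (p - 1))))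
    ≤ ∫ x in D, ∫ y in D, Lf p (w x) (w y) * (φ x ^ p * pk k (w x) - φ y ^ p * pk k (w y)) * K x y := by
  have hp0 : 0 < p := by linarith
  have hF := F_integrable hn hs0 hp hΛ hK hw (psi_memW hn hs1 hp hDo hDb hw hφ hk)
  have hB' : ball x₀ ρ' ⊆ D := (ball_subset_ball (by linarith)).trans hB
  rw [← integral_prod (f := fun z : Euc n × Euc n => Lf p (w z.1) (w z.2) *
    (φ z.1 ^ p * pk k (w z.1) - φ z.2 ^ p * pk k (w z.2)) * K z.1 z.2) hF]
  have pk0 : ∀ x, 0 ≤ pk k (w x) := fun x => pk_nonneg _ _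
  -- functions
  have hf' : Integrable ((ball x₀ ρ').indicator (fun x => pk k (w x) ^ p)) :=
    (integrable_indicator_iff measurableSet_ball).2 ((pkp_integrable hp hw hk).mono_set hB')
  have hf : Integrable ((ball x₀ ρ).indicator (fun x => pk k (w x) ^ p)) :=
    (integrable_indicator_iff measurableSet_ball).2 ((pkp_integrable hp hw hk).mono_set hB)
  have hf1 : Integrable ((ball x₀ ρ).indicator (fun x => pk k (w x))) :=
    (integrable_indicator_iff measurableSet_ball).2 ((pk1_integrable hp hDb hw hk).mono_set hB)
  have hf'0 : ∀ x, 0 ≤ (ball x₀ ρ').indicator (fun x => pk k (w x) ^ p) x := fun x =>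
    Set.indicator_nonneg (fun x _ => Real.rpow_nonneg (pk0 x) _) _
  have hf0 : ∀ x, 0 ≤ (ball x₀ ρ).indicator (fun x => pk k (w x) ^ p) x := fun x =>
    Set.indicator_nonneg (fun x _ => Real.rpow_nonneg (pk0 x) _) _
  have hf10 : ∀ x, 0 ≤ (ball x₀ ρ).indicator (fun x => pk k (w x)) x := fun x =>
    Set.indicator_nonneg (fun x _ => pk0 x) _
  have hwp := wpow_integrable hp hDb hw
  have hκ := kap_integrable (n := n) (s := s) (p := p) (R₁ + R₁) hn hs1 hp
  obtain ⟨g1, g2⟩ := G_lower (k := k) hn hDo hDb hw.1 hB hR hρ hf' hf'0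
    (fun x hx => Set.indicator_of_notMem hx _) hm
  obtain ⟨a1, a2⟩ := conv_fst_restrict hf hκ (kap_neg n s p _) hf0 (kap_nonneg n s p _) D
  obtain ⟨b1, b2⟩ := conv_snd_restrict hf hκ hf0 (kap_nonneg n s p _) D
  have c1 := (hf1.integrableOn (s := D)).mul_prod hwp
  have c2 := hwp.mul_prod (hf1.integrableOn (s := D))
  have d1 := integral_prod_mul (μ := volume.restrict D) (ν := volume.restrict D)
    ((ball x₀ ρ).indicator (fun x => pk k (w x))) (fun x => |w x| ^ (p - 1))
  have d2 := integral_prod_mul (μ := volume.restrict D) (ν := volume.restrict D)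
     (fun x => |w x| ^ (p - 1)) ((ball x₀ ρ).indicator (fun x => pk k (w x)))
  have i1 : ∫ x in D, (ball x₀ ρ).indicator (fun x => pk k (w x)) x = ∫ x in ball x₀ ρ, pk k (w x) := by
    rw [setIntegral_indicator measurableSet_ball, Set.inter_eq_right.2 hB]
  rw [i1] at d1 d2
  rw [integral_indicator measurableSet_ball] at g2 a2 b2
  set G : Euc n × Euc n → ℝ := fun z => (ball x₀ ρ').indicator (fun x => pk k (w x) ^ p) z.1 *
      ((ball x₀ ρ).indicator (1 : Euc n → ℝ) z.2 *
      (Set.Iic k).indicator (1 : ℝ → ℝ) (w z.2) * (ball (0 : Euc n) R).indicator 1 (z.1 - z.2)) with hG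
  set E1 : Euc n × Euc n → ℝ := fun z => (ball x₀ ρ).indicator (fun x => pk k (w x) ^ p) z.1 *
    kap n s p (R₁ + R₁) (z.1 - z.2) with hE1
  set E2 : Euc n × Euc n → ℝ := fun z => (ball x₀ ρ).indicator (fun x => pk k (w x) ^ p) z.2 *
    kap n s p (R₁ + R₁) (z.1 - z.2) with hE2
  set E3 : Euc n × Euc n → ℝ := fun z => (ball x₀ ρ).indicator (fun x => pk k (w x)) z.1 *
    |w z.2| ^ (p - 1) with hE3
  set E4 : Euc n × Euc n → ℝ := fun z => |w z.1| ^ (p - 1) *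
    (ball x₀ ρ).indicator (fun x => pk k (w x)) z.2 with hE4
  set cp := (min 1 (1 / (p - 1))) ^ (1 - p) with hcp
  have hcp0 : 0 ≤ cp := by
    have : 0 < p - 1 := by linarith
    rw [hcp]; positivity
  set σ := (n : ℝ) + s * p with hσ
  have hmono : ∫ z, (Λ⁻¹ / R ^ σ * G z - (cp * Λ * L ^ p * (E1 z + E2 z) + Λ * L ^ σ * (E3 z + E4 z)))
      ∂((volume.restrict D).prod (volume.restrict D)) ≤
      ∫ z : Euc n × Euc n, Lf p (w z.1) (w z.2) *
    (φ z.1 ^ p * pk k (w z.1) - φ z.2 ^ p * pk k (w z.2)) * K z.1 z.2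
      ∂((volume.restrict D).prod (volume.restrict D)) := by
    refine integral_mono_ae ((g1.const_mul _).sub (((a1.add b1).const_mul _).add ((c1.add c2).const_mul _))) hF ?_
    have hae := ae_restrict_of_ae (s := D ×ˢ D) (kernel_ae hn hs0 hp hΛ hK)
    rw [Measure.prod_restrict]
    filter_upwards [hae, ae_restrict_mem (hDo.measurableSet.prod hDo.measurableSet)] with z hz hzD
    have hzz : ‖z.1 - z.2‖ < R₁ + R₁ := by
      have h1 := hR₁ hzD.1
      have h2 := hR₁ hzD.2
      rw [mem_ball_zero_iff] at h1 h2
      exact (norm_sub_le _ _).trans_lt (by linarith)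
    exact pointwise_bound hn hs0 hp hΛ hK hφ hL (by linarith) hφ1 hφ0 hk hR hz.1 hzz hz.2.1 hz.2.2
  refine le_trans ?_ hmono
  rw [int_lin _ _ _ g1 a1 b1 c1 c2, d1, d2]
  have hΛ0 : 0 < Λ := by linarith
  have s1 := mul_le_mul_of_nonneg_left g2 (show 0 ≤ Λ⁻¹ / R ^ σ by positivity)
  have s2 := mul_le_mul_of_nonneg_left (add_le_add a2 b2) (show 0 ≤ cp * Λ * L ^ p by positivity)
  have s3 : Λ * L ^ σ * (2 * ((∫ x in ball x₀ ρ, pk k (w x)) * ∫ x in D, |w x| ^ (p - 1))) =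
     Λ * L ^ σ * ((∫ x in ball x₀ ρ, pk k (w x)) * (∫ x in D, |w x| ^ (p - 1)) +
       (∫ x in D, |w x| ^ (p - 1)) * (∫ x in ball x₀ ρ, pk k (w x))) := by ring
  rw [s3, two_mul]
  linarith

lemma integral_ge_neg {X : Type*} [MeasurableSpace X] {μ : Measure X} {f g : X → ℝ}
    (hg : Integrable g μ) (hg0 : 0 ≤ᵐ[μ] g) (h : ∀ᵐ x ∂μ, -g x ≤ f x) :
    -∫ x, g x ∂μ ≤ ∫ x, f x ∂μ := by
  by_cases hf : Integrable f μ
  · rw [← integral_neg]; exact integral_mono_ae hg.neg hf h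
  · rw [integral_undef hf]; have := integral_nonneg_of_ae hg0; linarith

lemma II_lower {n : ℕ} {s p Λ : ℝ} (hn : 1 ≤ n) (hs0 : 0 < s) (hp : 1 < p) (hΛ : 1 ≤ Λ)
    {K : Euc n → Euc n → ℝ} (hK : IsKernel n s p Λ K)
    {Ω D : Set (Euc n)} (hDo : IsOpen D) (hDb : Bornology.IsBounded D)
    {w gw φ : Euc n → ℝ} (hw : MemW n s p D w)
    {x₀ : Euc n} {r ρ L k : ℝ} (hr : 0 < r) (hρr : ρ ≤ r) (hφ : Cut n x₀ ρ L φ) (hL : 0 < L)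
    (hLr : 1 ≤ r * L)
    (hB : ball x₀ r ⊆ D) (hφ0 : ∀ x, φ x ≠ 0 → ‖x - x₀‖ ≤ ρ - 1 / L)
    (hk : 0 ≤ k)
    (hT : IntegrableOn (fun y => |gw y| ^ (p - 1) * ‖y - x₀‖ ^ (-((n : ℝ) + s * p))) (ball x₀ r)ᶜ) :
    -(Λ * (r * L) ^ ((n : ℝ) + s * p) *
      (∫ y in (ball x₀ r)ᶜ, |gw y| ^ (p - 1) * ‖y - x₀‖ ^ (-((n : ℝ) + s * p))) *
      ∫ x in ball x₀ ρ, pk k (w x)) ≤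
    ∫ y in Dᶜ, ∫ x in Ω, Lf p (w x) (gw y) * (φ x ^ p * pk k (w x)) * K x y := by
  set σ := (n : ℝ) + s * p with hσ
  have hσ0 : 0 < σ := by positivity
  have hΛ0 : 0 < Λ := by linarith
  have hsub : Dᶜ ⊆ (ball x₀ r)ᶜ := Set.compl_subset_compl.2 hB
  set T : Euc n → ℝ := fun y => |gw y| ^ (p - 1) * ‖y - x₀‖ ^ (-σ) with hTdef
  have hT0 : ∀ y, 0 ≤ T y := fun y => by positivity
  set b : Euc n → ℝ := (ball x₀ ρ).indicator (fun x => pk k (w x)) with hb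
  have hb0 : ∀ x, 0 ≤ b x := fun x => Set.indicator_nonneg (fun _ _ => pk_nonneg _ _) _
  have hbi : Integrable b := by
    rw [hb, integrable_indicator_iff measurableSet_ball]
    exact (pk1_integrable hp hDb hw hk).mono_set ((ball_subset_ball hρr).trans hB)
  have hbe : ∫ x, b x = ∫ x in ball x₀ ρ, pk k (w x) := integral_indicator measurableSet_ball
  rw [← hbe]
  have hbI : 0 ≤ ∫ x, b x := integral_nonneg hb0
  set C := Λ * (r * L) ^ σ with hC
  have hC0 : 0 ≤ C := by positivity
  have hae := Measure.ae_ae_of_ae_prod (kernel_ae hn hs0 hp hΛ hK)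
  have hIntg : IntegrableOn (fun y => C * T y * ∫ x, b x) Dᶜ :=
    ((hT.mono_set hsub).const_mul C).mul_const _
  have h1 : -∫ y in Dᶜ, (C * T y * ∫ x, b x) ≤
      ∫ y in Dᶜ, ∫ x in Ω, Lf p (w x) (gw y) * (φ x ^ p * pk k (w x)) * K x y := by
    refine integral_ge_neg hIntg (Eventually.of_forall fun y => by have := hT0 y; positivity) ?_
    filter_upwards [ae_restrict_of_ae hae, ae_restrict_mem hDo.measurableSet.compl] with y hy hyD
    have hy' : r ≤ ‖y - x₀‖ := by
      have := hsub hyD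
      rw [Set.mem_compl_iff, mem_ball, dist_eq_norm] at this
      linarith
    have h2 : -∫ x in Ω, C * T y * b x ≤
        ∫ x in Ω, Lf p (w x) (gw y) * (φ x ^ p * pk k (w x)) * K x y := by
      refine integral_ge_neg (hbi.integrableOn.const_mul _)
        (Eventually.of_forall fun x => by have := hT0 y; have := hb0 x; positivity) ?_
      filter_upwards [ae_restrict_of_ae hy] with x hx
      obtain ⟨hx0, -, hx2⟩ := hx
      by_cases hφx : φ x = 0
      · rw [hφx, Real.zero_rpow (by linarith)]
        have := hT0 y; have := hb0 x
        have : 0 ≤ C * T y * b x := by positivity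
        simpa using this
      have hxρ : x ∈ ball x₀ ρ := by by_contra hc; exact hφx (hφ.zero x hc)
      have hbx : b x = pk k (w x) := Set.indicator_of_mem hxρ _
      have hpk := pk_nonneg k (w x)
      have hφp := hφ.rpow_le_one hp x
      have hφp0 : 0 ≤ φ x ^ p := Real.rpow_nonneg (hφ.nonneg x) _
      have hp2 := pw2 hp hk (w x) (gw y) hφp0
      have hK0 := hK.2.2.1 x y
      have hd : ‖y - x₀‖ / (r * L) ≤ ‖y - x‖ := by
        have hx3 := hφ0 x hφx
        have t1 : ‖y - x₀‖ ≤ ‖y - x‖ + ‖x - x₀‖ := by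
          have := norm_add_le (y - x) (x - x₀); simpa using this
        have hrL : 0 < r * L := by positivity
        have e : ‖y - x₀‖ - r + 1 / L - ‖y - x₀‖ / (r * L) =
          (‖y - x₀‖ - r) * (r * L - 1) / (r * L) := by field_simp; ring
        have : 0 ≤ (‖y - x₀‖ - r) * (r * L - 1) / (r * L) :=
          div_nonneg (mul_nonneg (by linarith) (by linarith)) hrL.le
        linarith
      have hy0 : 0 < ‖y - x₀‖ := by linarith
      have hKb : K x y ≤ C * ‖y - x₀‖ ^ (-σ) := by
        rw [hK.2.1 x y]
        refine hx2.trans ?_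
        have : (‖y - x₀‖ / (r * L)) ^ σ ≤ ‖y - x‖ ^ σ :=
          Real.rpow_le_rpow (by positivity) hd hσ0.le
        calc Λ / ‖y - x‖ ^ σ ≤ Λ / (‖y - x₀‖ / (r * L)) ^ σ := by gcongr
          _ = C * ‖y - x₀‖ ^ (-σ) := by
            rw [Real.div_rpow hy0.le (by positivity), Real.rpow_neg hy0.le, hC]
            field_simp
      have h3 := mul_le_mul_of_nonneg_right hp2 hK0
      refine le_trans ?_ h3
      rw [neg_mul, neg_le_neg_iff, hbx]
      have : φ x ^ p * pk k (w x) ≤ pk k (w x) := mul_le_of_le_one_left hpk hφp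
      calc |gw y| ^ (p - 1) * (φ x ^ p * pk k (w x)) * K x y ≤
          |gw y| ^ (p - 1) * (pk k (w x)) * (C * ‖y - x₀‖ ^ (-σ)) := by gcongr
        _ = _ := by rw [hTdef]; ring
    refine le_trans ?_ h2
    rw [neg_le_neg_iff, integral_const_mul]
    have := hT0 y
    exact mul_le_mul_of_nonneg_left (setIntegral_le_integral hbi (Eventually.of_forall hb0)) (by positivity)
  refine le_trans ?_ h1
  rw [neg_le_neg_iff, integral_mul_const, integral_const_mul]
  have : ∫ y in Dᶜ, T y ≤ ∫ y in (ball x₀ r)ᶜ, T y :=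
    setIntegral_mono_set hT (Eventually.of_forall hT0) hsub.eventuallyLE
  gcongr

lemma exists_cut {n : ℕ} (x₀ : Euc n) {ρ' ρ : ℝ} (h : ρ' < ρ) : ∃ φ : Euc n → ℝ,
    Cut n x₀ ρ (2 / (ρ - ρ')) φ ∧ (∀ x ∈ ball x₀ ρ', φ x = 1) ∧
    ∀ x, φ x ≠ 0 → ‖x - x₀‖ ≤ ρ - 1 / (2 / (ρ - ρ')) := by
  have hd : 0 < ρ - ρ' := by linarith
  have hL : 0 < 2 / (ρ - ρ') := by positivity
  set L := 2 / (ρ - ρ') with hLd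
  have hL' : 1 / L = (ρ - ρ') / 2 := by rw [hLd]; field_simp
  have h0 : ∀ x : Euc n, max 0 (min 1 ((ρ - 1 / L - ‖x - x₀‖) * L)) ≠ 0 → ‖x - x₀‖ ≤ ρ - 1 / L := by
    intro x hx
    by_contra hc
    apply hx
    apply max_eq_left
    apply (min_le_right _ _).trans
    apply mul_nonpos_of_nonpos_of_nonneg _ hL.le
    linarith
  refine ⟨fun x => max 0 (min 1 ((ρ - 1 / L - ‖x - x₀‖) * L)), ⟨hL.le, ?_, ?_, ?_, ?_⟩, ?_, h0⟩
  · intro x y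
    refine (abs_max_sub_max_le_max _ _ _ _).trans ?_
    rw [sub_self, abs_zero]
    refine max_le (by positivity) ?_
    refine (abs_min_sub_min_le_max _ _ _ _).trans ?_
    rw [sub_self, abs_zero]
    refine max_le (by positivity) ?_
    rw [← sub_mul, abs_mul, abs_of_pos hL, mul_comm]
    refine mul_le_mul_of_nonneg_left ?_ hL.le
    have := abs_norm_sub_norm_le (y - x₀) (x - x₀)
    rw [show y - x₀ - (x - x₀) = -(x - y) by abel, norm_neg] at this
    rwa [show ρ - 1 / L - ‖x - x₀‖ - (ρ - 1 / L - ‖y - x₀‖) = ‖y - x₀‖ - ‖x - x₀‖ by ring]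
  · intro x; exact le_max_left _ _
  · intro x; exact max_le zero_le_one (min_le_left _ _)
  · intro x hx
    by_contra hc
    have := h0 x hc
    rw [mem_ball, dist_eq_norm] at hx
    linarith
  · intro x hx
    rw [mem_ball, dist_eq_norm] at hx
    have : 1 ≤ (ρ - 1 / L - ‖x - x₀‖) * L := by
      have h2 : 1 / L ≤ (ρ - 1 / L - ‖x - x₀‖) := by linarith
      rwa [div_le_iff₀ hL] at h2
    simp only
    rw [min_eq_left this]; simp

set_option maxHeartbeats 1000000 in
lemma step {n : ℕ} {s p Λ : ℝ} (hn : 1 ≤ n) (hs0 : 0 < s) (hs1 : s < 1) (hp : 1 < p) (hΛ : 1 ≤ Λ)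
    {K : Euc n → Euc n → ℝ} (hK : IsKernel n s p Λ K)
    {Ω D : Set (Euc n)} (hDo : IsOpen D) (hDb : Bornology.IsBounded D)
    {w gw : Euc n → ℝ} (hw : MemW n s p D w)
    {x₀ : Euc n} {r M : ℝ} (hr : 0 < r) (hB : ball x₀ r ⊆ D) (hM : 0 ≤ M)
    (hT : IntegrableOn (fun y => |gw y| ^ (p - 1) * ‖y - x₀‖ ^ (-((n : ℝ) + s * p))) (ball x₀ r)ᶜ)
    (hsub : ∀ k ≥ M, ∀ L φ, Cut n x₀ r L φ →
      Aop n p Ω D gw K w (fun x => φ x ^ p * pk k (w x)) ≤ 0) :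
    ∃ C1 : ℝ, 0 ≤ C1 ∧ ∀ ρ' ρ k R : ℝ, 0 < ρ' → ρ' < ρ → ρ ≤ r → M ≤ k → 0 < R → R ≤ ρ - ρ' →
      ∫ y in ball x₀ ρ, (Set.Ioi k).indicator (1 : ℝ → ℝ) (w y) ≤
      (volume : Measure (Euc n)).real (ball 0 1) * R ^ n / 2 →
      ∫ x in ball x₀ ρ', pk k (w x) ^ p ≤ C1 * R ^ (s * p) *
        ((1 / (ρ - ρ')) ^ p * (∫ x in ball x₀ ρ, pk k (w x) ^ p) +
         (1 / (ρ - ρ')) ^ ((n : ℝ) + s * p) * ∫ x in ball x₀ ρ, pk k (w x)) := by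
  obtain ⟨R₁, hR₁⟩ := hDb.subset_ball (0 : Euc n)
  set σ := (n : ℝ) + s * p with hσ
  have hσ0 : 0 < σ := by positivity
  have hΛ0 : 0 < Λ := by linarith
  have hp1 : 0 < p - 1 := by linarith
  set V := (volume : Measure (Euc n)).real (ball 0 1) with hV
  have hV0 : 0 < V := by
    rw [hV, Measure.real]
    exact ENNReal.toReal_pos (measure_ball_pos _ _ one_pos).ne' measure_ball_lt_top.ne
  set T2 := ∫ y in (ball x₀ r)ᶜ, |gw y| ^ (p - 1) * ‖y - x₀‖ ^ (-σ) with hT2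
  have hT20 : 0 ≤ T2 := integral_nonneg fun y => by positivity
  set cp := (min 1 (1 / (p - 1))) ^ (1 - p) with hcp
  have hcp0 : 0 ≤ cp := by rw [hcp]; positivity
  set κ := ∫ z, kap n s p (R₁ + R₁) z with hκ
  have hκ0 : 0 ≤ κ := integral_nonneg fun z => kap_nonneg n s p _ z
  set W := ∫ x in D, |w x| ^ (p - 1) with hW
  have hW0 : 0 ≤ W := integral_nonneg fun y => by positivity
  set α := cp * Λ * 2 ^ p * 2 * κ with hα
  set β := Λ * 2 ^ σ * (2 * W) + 2 * (Λ * (r * 2) ^ σ * T2) with hβ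
  have hα0 : 0 ≤ α := by positivity
  have hβ0 : 0 ≤ β := by positivity
  refine ⟨Λ * 2 / V * (α + β), by positivity, ?_⟩
  intro ρ' ρ k R hρ' hρ hρr hk hR hRρ hm
  obtain ⟨φ, hφ, hφ1, hφ0⟩ := exists_cut x₀ hρ
  have hd : 0 < ρ - ρ' := by linarith
  set d := ρ - ρ' with hd'
  have hL : 0 < 2 / d := by positivity
  have hk0 : 0 ≤ k := hM.trans hk
  have hI := I_lower hn hs0 hs1 hp hΛ hK hDo hDb hR₁ hw hφ hL ((ball_subset_ball hρr).trans hB) hR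
    (by linarith) hφ1 hφ0 hk0 hm
  have hLr : 1 ≤ r * (2 / d) := by
    rw [mul_div_assoc', le_div_iff₀ hd]; linarith
  have hII := II_lower (Ω := Ω) hn hs0 hp hΛ hK hDo hDb hw hr hρr hφ hL hLr hB hφ0 hk0 hT
  have hA := hsub k hk (2 / d) φ ⟨hφ.L0, hφ.lip, hφ.nonneg, hφ.le_one,
    fun x hx => hφ.zero x fun h => hx (ball_subset_ball hρr h)⟩
  unfold Aop at hA
  rw [← hσ, ← hT2] at hII
  rw [← hσ, ← hV, ← hcp, ← hκ, ← hW] at hI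
  set P' := ∫ x in ball x₀ ρ', pk k (w x) ^ p
  set P := ∫ x in ball x₀ ρ, pk k (w x) ^ p with hP
  set Q := ∫ x in ball x₀ ρ, pk k (w x) with hQ
  have hP0 : 0 ≤ P := integral_nonneg fun y => by have := pk_nonneg k (w y); positivity
  have hQ0 : 0 ≤ Q := integral_nonneg fun y => pk_nonneg k (w y)
  have e1 : (2 / d) ^ p = 2 ^ p * (1 / d) ^ p := by
    rw [← Real.mul_rpow (by norm_num) (by positivity)]; congr 1; ring
  have e2 : (2 / d) ^ σ = 2 ^ σ * (1 / d) ^ σ := by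
    rw [← Real.mul_rpow (by norm_num) (by positivity)]; congr 1; ring
  have e3 : (r * (2 / d)) ^ σ = (r * 2) ^ σ * (1 / d) ^ σ := by
    rw [← Real.mul_rpow (by positivity) (by positivity)]; congr 1; ring
  rw [e1, e2] at hI
  rw [e3] at hII
  have e4 : Λ⁻¹ / R ^ σ * (V * R ^ n / 2 * P') = (V / (Λ * 2)) / R ^ (s * p) * P' := by
    rw [hσ, Real.rpow_add hR, Real.rpow_natCast]; field_simp
  rw [e4] at hI
  have main : (V / (Λ * 2)) / R ^ (s * p) * P' ≤ α * ((1 / d) ^ p * P) + β * ((1 / d) ^ σ * Q) := by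
    have : α * ((1 / d) ^ p * P) + β * ((1 / d) ^ σ * Q) =
      cp * Λ * (2 ^ p * (1 / d) ^ p) * (2 * (P * κ)) + Λ * (2 ^ σ * (1 / d) ^ σ) * (2 * (Q * W))
      + 2 * (Λ * ((r * 2) ^ σ * (1 / d) ^ σ) * T2 * Q) := by rw [hα, hβ]; ring
    rw [this]; linarith only [hI, hII, hA]
  have hRs : 0 < R ^ (s * p) := by positivity
  have m2 : α * ((1 / d) ^ p * P) + β * ((1 / d) ^ σ * Q) ≤
    (α + β) * ((1 / d) ^ p * P + (1 / d) ^ σ * Q) := by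
    have x1 : 0 ≤ (1 / d) ^ p * P := by positivity
    have x2 : 0 ≤ (1 / d) ^ σ * Q := by positivity
    have x3 := mul_nonneg hα0 x2
    have x4 := mul_nonneg hβ0 x1
    generalize (1 / d) ^ p * P = X at *
    generalize (1 / d) ^ σ * Q = Y at *
    rw [show (α + β) * (X + Y) = α * X + β * Y + (α * Y + β * X) by ring]
    linarith only [x3, x4]
  have m3 := main.trans m2
  rw [div_mul_eq_mul_div, div_le_iff₀ hRs, div_mul_eq_mul_div, div_le_iff₀ (by positivity)] at m3
  calc P' = (V * P') / V := by field_simp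
    _ ≤ _ := by rw [div_le_iff₀ hV0]; refine m3.trans (le_of_eq ?_); field_simp

set_option maxHeartbeats 1000000 in
lemma iter {n : ℕ} {s p V C1 r M : ℝ} (hs0 : 0 < s) (hp : 1 < p) (hV : 0 < V) (hC1 : 0 ≤ C1)
    (hr : 0 < r) (P Q N : ℝ → ℝ → ℝ)
    (hstep : ∀ ρ' ρ k R : ℝ, 0 < ρ' → ρ' < ρ → ρ ≤ r → M ≤ k → 0 < R → R ≤ ρ - ρ' →
      N ρ k ≤ V * R ^ n / 2 → P ρ' k ≤ C1 * R ^ (s * p) *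
        ((1 / (ρ - ρ')) ^ p * P ρ k + (1 / (ρ - ρ')) ^ ((n : ℝ) + s * p) * Q ρ k))
    (hP0 : ∀ ρ k, 0 ≤ P ρ k)
    (hPm : ∀ ρ k e, ρ ≤ r → M ≤ k → 0 < e → P ρ (k + e) ≤ P ρ k)
    (hQ : ∀ ρ k e, ρ ≤ r → M ≤ k → 0 < e → Q ρ (k + e) ≤ (1 / e) ^ (p - 1) * P ρ k)
    (hN : ∀ ρ k e, ρ ≤ r → M ≤ k → 0 < e → N ρ (k + e) ≤ (1 / e) ^ p * P ρ k) :
    ∃ k η : ℝ, 0 < k ∧ 0 < η ∧ ∀ j : ℕ, P (r / 2 * (1 + 1 / 2 ^ j)) (M + k * (1 - 1 / 2 ^ j)) ≤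
      P r M * ((2 : ℝ) ^ j) ^ (-η) := by
  set σ := (n : ℝ) + s * p with hσ
  have hsp : 0 < s * p := by positivity
  have hσ0 : 0 < σ := by positivity
  have hσsp : s * p ≤ σ := by rw [hσ]; linarith [(Nat.cast_nonneg n : (0 : ℝ) ≤ n)]
  set τ := (σ + p) / (s * p) with hτ
  have hτ1 : 1 ≤ τ := by rw [hτ, le_div_iff₀ hsp]; linarith
  have hτsp : τ * (s * p) = σ + p := by rw [hτ]; field_simp
  set η := τ * n + p with hη
  have hη0 : 0 < η := by positivity
  set C2 := C1 * ((4 / r) ^ p + (4 / r) ^ σ) with hC2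
  have hC20 : 0 ≤ C2 := by positivity
  set Z := ((2 : ℝ) ^ (-η) / (C2 + 1)) ^ (1 / (s * p)) with hZ
  have hZ0 : 0 < Z := by positivity
  have hZ1 : Z ^ (s * p) = (2 : ℝ) ^ (-η) / (C2 + 1) := by
    rw [hZ, ← Real.rpow_mul (by positivity)]
    rw [one_div_mul_cancel hsp.ne', Real.rpow_one]
  set R0 := min (r / 4) Z with hR0
  have hR00 : 0 < R0 := by rw [hR0]; positivity
  have hR0r : R0 ≤ r / 4 := min_le_left _ _
  have hCR : C2 * R0 ^ (s * p) ≤ (2 : ℝ) ^ (-η) := by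
    have h1 : R0 ^ (s * p) ≤ Z ^ (s * p) := Real.rpow_le_rpow hR00.le (min_le_right _ _) hsp.le
    rw [hZ1] at h1
    have h2 : 0 < (2 : ℝ) ^ (-η) := by positivity
    calc C2 * R0 ^ (s * p) ≤ C2 * ((2 : ℝ) ^ (-η) / (C2 + 1)) := by gcongr
      _ = (2 : ℝ) ^ (-η) * (C2 / (C2 + 1)) := by ring
      _ ≤ (2 : ℝ) ^ (-η) * 1 := by gcongr; rw [div_le_one (by linarith)]; linarith
      _ = _ := mul_one _
  set c := 2 * P r M / (V * R0 ^ n) with hc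
  have hY := hP0 r M
  have hc0 : 0 ≤ c := by positivity
  set k := 2 * (1 + c) with hk
  have hk2 : 2 ≤ k := by linarith
  refine ⟨k, η, by linarith, hη0, ?_⟩
  intro j
  induction j with
  | zero => simp [show r / 2 * (1 + 1) = r by ring]
  | succ j ih =>
    set a : ℝ := 2 ^ j with ha
    have ha1 : 1 ≤ a := one_le_pow₀ (by norm_num)
    have ha0 : 0 < a := by linarith
    have hs2 : (2 : ℝ) ^ (j + 1) = 2 * a := by rw [ha, pow_succ]; ring
    rw [hs2]
    set ρ := r / 2 * (1 + 1 / a) with hρ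
    set ρ' := r / 2 * (1 + 1 / (2 * a)) with hρ'
    set kj := M + k * (1 - 1 / a) with hkj
    have ha1' : 1 / a ≤ 1 := by rw [div_le_one ha0]; exact ha1
    have hδ : ρ - ρ' = r / (4 * a) := by rw [hρ, hρ']; field_simp; ring
    have hδ0 : 0 < r / (4 * a) := by positivity
    have hδi : 1 / (ρ - ρ') = 4 / r * a := by rw [hδ]; field_simp
    set e := k / (2 * a) with he
    have he0 : 0 < e := by rw [he]; positivity
    have hei : 1 / e ≤ a := by
      rw [he, one_div_div, div_le_iff₀ (by linarith), mul_comm]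
      exact mul_le_mul_of_nonneg_left hk2 ha0.le
    have hkk : M + k * (1 - 1 / (2 * a)) = kj + e := by rw [hkj, he]; field_simp; ring
    rw [hkk]
    have hρr : ρ ≤ r := by
      have := mul_le_mul_of_nonneg_left ha1' (half_pos hr).le
      rw [hρ, mul_add]; linarith only [this]
    have hkM : M ≤ kj := by
      have := mul_nonneg (show 0 ≤ k by linarith only [hk2]) (sub_nonneg.2 ha1')
      rw [hkj]; linarith only [this]
    have hYj := hP0 ρ kj
    set Y := P ρ kj with hYd
    set R := R0 * a ^ (-τ) with hR
    have hRpos : 0 < R := by positivity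
    have hRsp : R ^ (s * p) = R0 ^ (s * p) * a ^ (-(σ + p)) := by
      rw [hR, Real.mul_rpow hR00.le (by positivity), ← Real.rpow_mul ha0.le, neg_mul, hτsp]
    have hRn : R ^ n = R0 ^ n * a ^ (-(τ * n)) := by
      rw [hR, mul_pow, ← Real.rpow_natCast (a ^ (-τ)), ← Real.rpow_mul ha0.le, neg_mul]
    have hRδ : R ≤ ρ - ρ' := by
      rw [hδ, hR]
      have : a ^ (-τ) ≤ a ^ (-1 : ℝ) := Real.rpow_le_rpow_of_exponent_le ha1 (by linarith)
      rw [Real.rpow_neg_one] at this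
      calc R0 * a ^ (-τ) ≤ r / 4 * a⁻¹ := by gcongr
        _ = _ := by field_simp
    have hNj : N ρ (kj + e) ≤ V * R ^ n / 2 := by
      refine (hN ρ kj e hρr hkM he0).trans ?_
      have h1 : (1 / e) ^ p ≤ (1 / (1 + c)) * a ^ p := by
        have : 1 / e = (1 / (1 + c)) * a := by rw [he, hk]; field_simp
        rw [this, Real.mul_rpow (by positivity) ha0.le]
        refine mul_le_mul_of_nonneg_right ?_ (by positivity)
        have h3 : 1 / (1 + c) ≤ 1 := by rw [div_le_one (by linarith)]; linarith
        have := Real.rpow_le_rpow_of_exponent_ge (show 0 < 1 / (1 + c) by positivity) h3 hp.le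
        rwa [Real.rpow_one] at this
      have h2 : P r M * (1 / (1 + c)) ≤ V * R0 ^ n / 2 := by
        have : P r M = c * (V * R0 ^ n) / 2 := by rw [hc]; field_simp
        rw [mul_one_div, div_le_iff₀ (by linarith), this]
        have : 0 < V * R0 ^ n := by positivity
        nlinarith
      calc (1 / e) ^ p * Y ≤ ((1 / (1 + c)) * a ^ p) * (P r M * a ^ (-η)) := by gcongr
        _ = P r M * (1 / (1 + c)) * (a ^ p * a ^ (-η)) := by ring
        _ = P r M * (1 / (1 + c)) * a ^ (-(τ * n)) := by
          rw [← Real.rpow_add ha0]; congr 2; rw [hη]; ring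
        _ ≤ V * R0 ^ n / 2 * a ^ (-(τ * n)) := by gcongr
        _ = _ := by rw [hRn]; ring
    have hρ0 : 0 < ρ' := by rw [hρ']; positivity
    have hS := hstep ρ' ρ (kj + e) R hρ0 (by linarith) hρr (by linarith) hRpos hRδ hNj
    refine hS.trans ?_
    rw [hδi]
    have b1 := hPm ρ kj e hρr hkM he0
    have b2 := hQ ρ kj e hρr hkM he0
    have b3 : (1 / e) ^ (p - 1) ≤ a ^ (p - 1) := Real.rpow_le_rpow (by positivity) hei (by linarith)
    have b4 : Q ρ (kj + e) ≤ a ^ (p - 1) * Y := b2.trans (mul_le_mul_of_nonneg_right b3 hYj)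
    have b5 : (4 / r * a) ^ p * P ρ (kj + e) ≤ (4 / r) ^ p * a ^ (σ + p) * Y := by
      rw [Real.mul_rpow (by positivity) ha0.le]
      have : a ^ p ≤ a ^ (σ + p) := Real.rpow_le_rpow_of_exponent_le ha1 (by linarith)
      have := hP0 ρ (kj + e)
      gcongr
    have b6 : (4 / r * a) ^ σ * Q ρ (kj + e) ≤ (4 / r) ^ σ * a ^ (σ + p) * Y := by
      rw [Real.mul_rpow (by positivity) ha0.le]
      have h1 : a ^ σ * a ^ (p - 1) ≤ a ^ (σ + p) := by
        rw [← Real.rpow_add ha0]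
        exact Real.rpow_le_rpow_of_exponent_le ha1 (by linarith)
      calc (4 / r) ^ σ * a ^ σ * Q ρ (kj + e) ≤ (4 / r) ^ σ * a ^ σ * (a ^ (p - 1) * Y) := by gcongr
        _ = (4 / r) ^ σ * (a ^ σ * a ^ (p - 1)) * Y := by ring
        _ ≤ _ := by gcongr
    have haa : a ^ (-(σ + p)) * a ^ (σ + p) = 1 := by
      rw [← Real.rpow_add ha0]; simp
    calc C1 * R ^ (s * p) * ((4 / r * a) ^ p * P ρ (kj + e) + (4 / r * a) ^ σ * Q ρ (kj + e))
        ≤ C1 * R ^ (s * p) * ((4 / r) ^ p * a ^ (σ + p) * Y + (4 / r) ^ σ * a ^ (σ + p) * Y) := by gcongr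
      _ = C2 * R0 ^ (s * p) * (a ^ (-(σ + p)) * a ^ (σ + p)) * Y := by rw [hRsp, hC2]; ring
      _ = C2 * R0 ^ (s * p) * Y := by rw [haa, mul_one]
      _ ≤ (2 : ℝ) ^ (-η) * (P r M * a ^ (-η)) := by gcongr
      _ = P r M * (2 * a) ^ (-η) := by rw [Real.mul_rpow (by norm_num) ha0.le]; ring

lemma pk_mono {k k' : ℝ} (h : k ≤ k') (t : ℝ) : pk k' t ≤ pk k t := by
  unfold pk; exact max_le_max (by linarith) le_rfl

lemma pk_step1 {p k e : ℝ} (hp : 1 < p) (he : 0 < e) (t : ℝ) :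
    pk (k + e) t ≤ (1 / e) ^ (p - 1) * pk k t ^ p := by
  have h0 := pk_nonneg k t
  rcases le_total t (k + e) with h | h
  · rw [pk_of_le h]; positivity
  · have h1 : pk k t = t - k := pk_of_ge (by linarith)
    have h2 : e ≤ pk k t := by linarith
    have h3 : 0 < pk k t := by linarith
    have h4 : 1 ≤ (1 / e * pk k t) ^ (p - 1) :=
      Real.one_le_rpow (by rw [div_mul_eq_mul_div, le_div_iff₀ he]; linarith) (by linarith)
    rw [Real.mul_rpow (by positivity) h0] at h4
    have h5 : pk k t ^ p = pk k t ^ (p - 1) * pk k t := by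
      rw [← Real.rpow_add_one h3.ne']; congr 1; ring
    rw [h5, ← mul_assoc]
    exact (pk_mono (by linarith) t).trans (le_mul_of_one_le_left h0 h4)

lemma pk_step2 {p k e : ℝ} (hp : 1 < p) (he : 0 < e) (t : ℝ) :
    (Set.Ioi (k + e)).indicator (1 : ℝ → ℝ) t ≤ (1 / e) ^ p * pk k t ^ p := by
  have h0 := pk_nonneg k t
  by_cases h : t ∈ Set.Ioi (k + e)
  · rw [Set.indicator_of_mem h, Pi.one_apply]
    rw [Set.mem_Ioi] at h
    have h1 : pk k t = t - k := pk_of_ge (by linarith)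
    rw [← Real.mul_rpow (by positivity) h0]
    exact Real.one_le_rpow (by rw [div_mul_eq_mul_div, le_div_iff₀ he]; linarith) (by linarith)
  · rw [Set.indicator_of_notMem h]; positivity

lemma bound_above {n : ℕ} {s p Λ : ℝ} (hn : 1 ≤ n) (hs0 : 0 < s) (hs1 : s < 1) (hp : 1 < p) (hΛ : 1 ≤ Λ)
    {K : Euc n → Euc n → ℝ} (hK : IsKernel n s p Λ K)
    {Ω D : Set (Euc n)} (hDo : IsOpen D) (hDb : Bornology.IsBounded D)
    {w gw : Euc n → ℝ} (hw : MemW n s p D w)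
    {x₀ : Euc n} {r M : ℝ} (hr : 0 < r) (hB : ball x₀ r ⊆ D) (hM : 0 ≤ M)
    (hT : IntegrableOn (fun y => |gw y| ^ (p - 1) * ‖y - x₀‖ ^ (-((n : ℝ) + s * p))) (ball x₀ r)ᶜ)
    (hsub : ∀ k ≥ M, ∀ L φ, Cut n x₀ r L φ →
      Aop n p Ω D gw K w (fun x => φ x ^ p * pk k (w x)) ≤ 0) :
    ∃ N : ℝ, ∀ᵐ x ∂(volume.restrict (ball x₀ (r / 2))), w x ≤ N := by
  obtain ⟨C1, hC1, hst⟩ := step hn hs0 hs1 hp hΛ hK hDo hDb hw hr hB hM hT hsub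
  have hV0 : 0 < (volume : Measure (Euc n)).real (ball 0 1) :=
    ENNReal.toReal_pos (measure_ball_pos _ _ one_pos).ne' measure_ball_lt_top.ne
  have hsubD : ∀ ρ ≤ r, ball x₀ ρ ⊆ D := fun ρ hρ => (ball_subset_ball hρ).trans hB
  have i1 : ∀ ρ k, ρ ≤ r → M ≤ k → IntegrableOn (fun x => pk k (w x) ^ p) (ball x₀ ρ) :=
    fun ρ k hρ hk => (pkp_integrable hp hw (hM.trans hk)).mono_set (hsubD ρ hρ)
  have i2 : ∀ ρ k, ρ ≤ r → M ≤ k → IntegrableOn (fun x => pk k (w x)) (ball x₀ ρ) :=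
    fun ρ k hρ hk => (pk1_integrable hp hDb hw (hM.trans hk)).mono_set (hsubD ρ hρ)
  have hmono : ∀ ρ k k', ρ ≤ r → M ≤ k → k ≤ k' →
      ∫ x in ball x₀ ρ, pk k' (w x) ^ p ≤ ∫ x in ball x₀ ρ, pk k (w x) ^ p := by
    intro ρ k k' hρ hk hkk
    refine integral_mono (i1 ρ k' hρ (hk.trans hkk)) (i1 ρ k hρ hk) fun x => ?_
    exact Real.rpow_le_rpow (pk_nonneg _ _) (pk_mono hkk _) (by linarith)
  obtain ⟨k, η, hk, hη, hit⟩ := iter (n := n) (M := M) hs0 hp hV0 hC1 hr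
    (fun ρ k => ∫ x in ball x₀ ρ, pk k (w x) ^ p) (fun ρ k => ∫ x in ball x₀ ρ, pk k (w x))
    (fun ρ k => ∫ y in ball x₀ ρ, (Set.Ioi k).indicator (1 : ℝ → ℝ) (w y)) hst
    (fun ρ k => integral_nonneg fun x => by have := pk_nonneg k (w x); positivity)
    (fun ρ k e hρ hk he => hmono ρ k (k + e) hρ hk (by linarith))
    (fun ρ k e hρ hk he => by
      rw [← integral_const_mul]
      exact integral_mono (i2 ρ (k + e) hρ (by linarith)) ((i1 ρ k hρ hk).const_mul _)
        fun x => pk_step1 hp he _)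
    (fun ρ k e hρ hk he => by
      rw [← integral_const_mul]
      refine integral_mono_of_nonneg (Eventually.of_forall fun x => ?_) ((i1 ρ k hρ hk).const_mul _)
        (Eventually.of_forall fun x => pk_step2 hp he _)
      exact Set.indicator_nonneg (fun _ _ => zero_le_one) _)
  refine ⟨M + k, ?_⟩
  have hle : ∀ j : ℕ, ∫ x in ball x₀ (r / 2), pk (M + k) (w x) ^ p ≤
      (∫ x in ball x₀ r, pk M (w x) ^ p) * ((2 : ℝ) ^ j) ^ (-η) := by
    intro j
    refine le_trans ?_ (hit j)
    have ha0 : (0 : ℝ) < 2 ^ j := by positivity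
    have ha1 : (1 : ℝ) ≤ 2 ^ j := one_le_pow₀ (by norm_num)
    have h1 : 1 / (2 : ℝ) ^ j ≤ 1 := by rw [div_le_one ha0]; exact ha1
    have h0 : 0 < 1 / (2 : ℝ) ^ j := by positivity
    refine (hmono (r / 2) (M + k * (1 - 1 / 2 ^ j)) (M + k) (by linarith) (by nlinarith) (by nlinarith)).trans ?_
    refine setIntegral_mono_set (i1 _ _ (by nlinarith) (by nlinarith))
      (Eventually.of_forall fun x => ?_) (ball_subset_ball (by nlinarith)).eventuallyLE
    have := pk_nonneg (M + k * (1 - 1 / 2 ^ j)) (w x)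
    simp only [Pi.zero_apply]
    positivity
  have hlim : Tendsto (fun j : ℕ => (∫ x in ball x₀ r, pk M (w x) ^ p) * ((2 : ℝ) ^ j) ^ (-η)) atTop (𝓝 0) := by
    have := (tendsto_rpow_neg_atTop hη).comp (tendsto_pow_atTop_atTop_of_one_lt (one_lt_two : (1 : ℝ) < 2))
    simpa using this.const_mul (∫ x in ball x₀ r, pk M (w x) ^ p)
  have hz : ∫ x in ball x₀ (r / 2), pk (M + k) (w x) ^ p ≤ 0 := ge_of_tendsto' hlim hle
  have hnn : 0 ≤ᵐ[volume.restrict (ball x₀ (r / 2))] fun x => pk (M + k) (w x) ^ p :=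
    Eventually.of_forall fun x => Real.rpow_nonneg (pk_nonneg _ _) _
  have hz2 := (integral_eq_zero_iff_of_nonneg_ae hnn (i1 (r / 2) (M + k) (by linarith) (by linarith))).1
    (le_antisymm hz (integral_nonneg_of_ae hnn))
  filter_upwards [hz2] with x hx
  have hx' : pk (M + k) (w x) ^ p = 0 := hx
  rw [Real.rpow_eq_zero (pk_nonneg _ _) (by linarith)] at hx'
  unfold pk at hx'
  have := le_max_left (w x - (M + k)) 0
  linarith

lemma Aop_neg_right (n : ℕ) (p : ℝ) (Ω Ω' : Set (Euc n)) (g : Euc n → ℝ)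
    (K : Euc n → Euc n → ℝ) (u v : Euc n → ℝ) :
    Aop n p Ω Ω' g K u (fun x => - v x) = - Aop n p Ω Ω' g K u v := by
  unfold Aop
  have e1 : ∀ x y, Lf p (u x) (u y) * (-v x - -v y) * K x y =
    -(Lf p (u x) (u y) * (v x - v y) * K x y) := fun x y => by ring
  have e2 : ∀ x y, Lf p (u x) (g y) * -v x * K x y =
    -(Lf p (u x) (g y) * v x * K x y) := fun x y => by ring
  simp only [e1, e2, integral_neg]; ring

lemma Aop_neg_left (n : ℕ) (p : ℝ) (Ω Ω' : Set (Euc n)) (g : Euc n → ℝ)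
    (K : Euc n → Euc n → ℝ) (u v : Euc n → ℝ) :
    Aop n p Ω Ω' (fun x => - g x) K (fun x => - u x) v = - Aop n p Ω Ω' g K u v := by
  unfold Aop
  simp only [Lf_neg, neg_mul, integral_neg]; ring

lemma ball_sub_of_infDist {n : ℕ} {D : Set (Euc n)} {x₀ : Euc n} {r : ℝ} (hDo : IsOpen D) (hr : 0 < r) (hx : x₀ ∈ D)
    (hrd : r < Metric.infDist x₀ (frontier D)) : ball x₀ r ⊆ D := by
  have hcov : ∀ z ∈ ball x₀ r, z ∉ D → z ∈ (closure D)ᶜ := by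
    intro z hz hzD hzc
    have hzf : z ∈ frontier D := ⟨hzc, fun hi => hzD (interior_subset hi)⟩
    have := Metric.infDist_le_dist_of_mem (x := x₀) hzf
    rw [mem_ball, dist_comm] at hz
    linarith
  by_contra hc
  obtain ⟨y, hy, hyD⟩ := Set.not_subset.1 hc
  obtain ⟨z, -, hz1, hz2⟩ := (convex_ball x₀ r).isPreconnected D (closure D)ᶜ hDo
    isClosed_closure.isOpen_compl
    (fun z hz => (em (z ∈ D)).imp id (hcov z hz)) ⟨x₀, mem_ball_self hr, hx⟩ ⟨y, hy, hcov y hy hyD⟩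
  exact hz2 (subset_closure hz1)

/-- Theorem 5.3 (boundedness at the boundary): if the boundary data `g` and the obstacle `h`
are essentially bounded near `x₀ ∈ ∂Ω`, then the solution `u` of the obstacle problem is
essentially bounded in `B_{r/2}(x₀)`. -/
theorem boundedness_at_boundary
    (n : ℕ) (s p Λ : ℝ) (hn : 1 ≤ n) (hs0 : 0 < s) (hs1 : s < 1) (hp : 1 < p)
    (hΛ : 1 ≤ Λ) (K : Euc n → Euc n → ℝ) (hK : IsKernel n s p Λ K)
    (Ω Ω' : Set (Euc n)) (hΩo : IsOpen Ω) (hΩ'o : IsOpen Ω')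
    (hΩb : Bornology.IsBounded Ω) (hΩ'b : Bornology.IsBounded Ω') (hΩΩ' : closure Ω ⊆ Ω')
    (g : Euc n → ℝ) (h : Euc n → EReal)
    (hg : MemW n s p Ω' g) (hgt : MemTail n s p g)
    (hne : (obstacleSet n s p Ω Ω' g h).Nonempty)
    (u : Euc n → ℝ) (hu : SolvesObstacle n s p Ω Ω' g h K u)
    (x₀ : Euc n) (hx₀ : x₀ ∈ frontier Ω) (r : ℝ) (hr0 : 0 < r)
    (hrd : r < Metric.infDist x₀ (frontier Ω'))
    (hgb : essSup (fun x => (g x : EReal)) (volume.restrict (ball x₀ r)) < ⊤)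
    (hhb : essSup h (volume.restrict (ball x₀ r ∩ Ω)) < ⊤)
    (hgl : ⊥ < essInf (fun x => (g x : EReal)) (volume.restrict (ball x₀ r))) :
    essSup (fun x => ((|u x| : ℝ) : EReal)) (volume.restrict (ball x₀ (r/2))) < ⊤ := by
  have hB : ball x₀ r ⊆ Ω' := ball_sub_of_infDist hΩ'o hr0 (hΩΩ' (frontier_subset_closure hx₀)) hrd
  obtain ⟨M1, hM1, -⟩ := EReal.lt_iff_exists_real_btwn.1 hgb
  obtain ⟨M2, hM2, -⟩ := EReal.lt_iff_exists_real_btwn.1 hhb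
  obtain ⟨M3, -, hM3⟩ := EReal.lt_iff_exists_real_btwn.1 hgl
  have g1 : ∀ᵐ x, x ∈ ball x₀ r → g x ≤ M1 := by
    rw [← ae_restrict_iff' measurableSet_ball]
    filter_upwards [ae_le_essSup (f := fun x => (g x : EReal)) (μ := volume.restrict (ball x₀ r))] with x hx
    exact EReal.coe_le_coe_iff.1 (hx.trans hM1.le)
  have g2 : ∀ᵐ x, x ∈ ball x₀ r → M3 ≤ g x := by
    rw [← ae_restrict_iff' measurableSet_ball]
    filter_upwards [ae_essInf_le (f := fun x => (g x : EReal)) (μ := volume.restrict (ball x₀ r))] with x hx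
    exact EReal.coe_le_coe_iff.1 (hM3.le.trans hx)
  have h1 : ∀ᵐ x, x ∈ ball x₀ r ∩ Ω → h x ≤ (M2 : EReal) := by
    rw [← ae_restrict_iff' (measurableSet_ball.inter hΩo.measurableSet)]
    filter_upwards [ae_le_essSup (f := h) (μ := volume.restrict (ball x₀ r ∩ Ω))] with x hx
    exact hx.trans hM2.le
  set M := max 0 (max M1 (max M2 (-M3))) with hM
  have hM0 : 0 ≤ M := le_max_left _ _
  have m1 : M1 ≤ M := (le_max_left _ _).trans (le_max_right _ _)
  have m2 : M2 ≤ M := (le_max_left _ _).trans ((le_max_right _ _).trans (le_max_right _ _))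
  have m3 : -M3 ≤ M := (le_max_right _ _).trans ((le_max_right _ _).trans (le_max_right _ _))
  have hT := hgt.2.2 x₀ r hr0
  obtain ⟨⟨huW, huh, hug⟩, huA⟩ := hu
  have hz : (0 : ℝ) ^ p = 0 := Real.zero_rpow (by linarith)
  obtain ⟨N1, hN1⟩ := bound_above (Ω := Ω) (gw := g) hn hs0 hs1 hp hΛ hK hΩ'o hΩ'b huW hr0 hB hM0 hT (by
    intro k hk L φ hφ
    have hk0 : 0 ≤ k := hM0.trans hk
    have hv : (fun x => u x + -(φ x ^ p * pk k (u x))) ∈ obstacleSet n s p Ω Ω' g h := by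
      refine ⟨huW.add' hp (psi_memW hn hs1 hp hΩ'o hΩ'b huW hφ hk0).neg', ?_, ?_⟩
      · filter_upwards [huh, h1] with x hx hx1 hxΩ
        by_cases hxb : x ∈ ball x₀ r
        · rcases le_total (u x) k with hc | hc
          · simpa [pk_of_le hc] using hx hxΩ
          · refine (hx1 ⟨hxb, hxΩ⟩).trans (EReal.coe_le_coe_iff.2 ?_)
            rw [pk_of_ge hc]
            have := mul_le_of_le_one_left (sub_nonneg.2 hc) (hφ.rpow_le_one hp x)
            linarith
        · simpa [hφ.zero x hxb, hz] using hx hxΩ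
      · filter_upwards [hug, g1] with x hx hx1 hxΩ
        have hx2 := hx hxΩ
        by_cases hxb : x ∈ ball x₀ r
        · have : u x ≤ k := by rw [hx2]; linarith [hx1 hxb]
          simpa [pk_of_le this] using hx2
        · simpa [hφ.zero x hxb, hz] using hx2
    have hA := huA _ hv
    have e : (fun x => u x + -(φ x ^ p * pk k (u x)) - u x) = fun x => -(φ x ^ p * pk k (u x)) := by
      funext x; ring
    rw [e, Aop_neg_right] at hA
    linarith)
  obtain ⟨N2, hN2⟩ := bound_above (Ω := Ω) (gw := fun x => - g x) hn hs0 hs1 hp hΛ hK hΩ'o hΩ'b huW.neg' hr0 hB hM0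
    (by simpa using hT) (by
    intro k hk L φ hφ
    have hk0 : 0 ≤ k := hM0.trans hk
    have hv : (fun x => u x + φ x ^ p * pk k (-u x)) ∈ obstacleSet n s p Ω Ω' g h := by
      refine ⟨huW.add' hp (psi_memW hn hs1 hp hΩ'o hΩ'b huW.neg' hφ hk0), ?_, ?_⟩
      · filter_upwards [huh] with x hx hxΩ
        refine (hx hxΩ).trans (EReal.coe_le_coe_iff.2 ?_)
        have := mul_nonneg (Real.rpow_nonneg (hφ.nonneg x) p) (pk_nonneg k (-u x))
        linarith
      · filter_upwards [hug, g2] with x hx hx1 hxΩ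
        have hx2 := hx hxΩ
        by_cases hxb : x ∈ ball x₀ r
        · have : -u x ≤ k := by rw [hx2]; linarith [hx1 hxb]
          simpa [pk_of_le this] using hx2
        · simpa [hφ.zero x hxb, hz] using hx2
    have hA := huA _ hv
    have e : (fun x => u x + φ x ^ p * pk k (-u x) - u x) = fun x => φ x ^ p * pk k (-u x) := by
      funext x; ring
    rw [e] at hA
    rw [Aop_neg_left]
    linarith)
  refine lt_of_le_of_lt (essSup_le_of_ae_le ((max N1 N2 : ℝ) : EReal) ?_) (EReal.coe_lt_top _)
  filter_upwards [hN1, hN2] with x hx1 hx2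
  exact EReal.coe_le_coe_iff.2 (abs_le'.2 ⟨hx1.trans (le_max_left _ _), hx2.trans (le_max_right _ _)⟩)
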